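/- arXiv:2312.08382 — 10 statements merged into one kernel-verified Lean document; each statement's English description precedes it below -/
import Mathlib

section
/- The GM-move preserves monotonicity: if x = (x_1,…,x_n) is a position (i.e., x_1 ≤ ⋯ ≤ x_n), then its image G(x) under the GM-move satisfies G(x)_1 ≤ ⋯ ≤ G(x)_n. -/
namespace Screw

/-- The set of indices whose entries are multiples of `ℓ`. -/
def mulSet {n : ℕ} (ℓ : ℕ) (x : Fin n → ℤ) : Finset (Fin n) :=
  Finset.univ.filter (fun i => (ℓ : ℤ) ∣ x i)

/-- `m(x)`: the number of entries of `x` that are multiples of `ℓ`. -/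
def mcount {n : ℕ} (ℓ : ℕ) (x : Fin n → ℤ) : ℕ := (mulSet ℓ x).card

/-- The tie-breaking order: `i` precedes `j` iff `x i < x j`, or `x i = x j` and `i ≥ j`
(the rightmost index is preferred). -/
def tieLE {n : ℕ} (x : Fin n → ℤ) (i j : Fin n) : Bool :=
  decide (x i < x j ∨ (x i = x j ∧ j ≤ i))

/-- The bear set `P(x)`: if `m(x) ≥ n - k`, the `n - k` smallest (w.r.t. the tie-breaking
order) indices whose entries are multiples of `ℓ`; otherwise all of `M(x)` together with
the `n - k - m(x)` largest indices not in `M(x)`. -/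
noncomputable def bearSet {n : ℕ} (k ℓ : ℕ) (x : Fin n → ℤ) : Finset (Fin n) :=
  let M := mulSet ℓ x
  if n - k ≤ M.card then
    ((M.toList.mergeSort (tieLE x)).take (n - k)).toFinset
  else
    M ∪ (((Finset.univ \ M).toList.mergeSort (fun i j => decide (j ≤ i))).take
          (n - k - M.card)).toFinset

/-- The GM-move: bearish entries are kept, all other (bullish) entries are reduced by 1. -/
noncomputable def gmMove {n : ℕ} (k ℓ : ℕ) (x : Fin n → ℤ) : Fin n → ℤ :=
  fun i => if i ∈ bearSet k ℓ x then x i else x i - 1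

/-- `range(x) = x_n - x_1` (for a monotone `x`). -/
def rangeOf {n : ℕ} (x : Fin n → ℤ) : ℤ :=
  if h : 0 < n then x ⟨n - 1, by omega⟩ - x ⟨0, h⟩ else 0

/-- A cyclic interval of `{1,…,n}` (here `Fin n`): the empty set, the full set,
an ordinary interval `{a,…,b}` (`a ≤ b`), or a wrap-around interval
`{a,…,n} ∪ {1,…,b}` (`b < a`). -/
def IsCyclicInterval {n : ℕ} (I : Finset (Fin n)) : Prop :=
  I = ∅ ∨ I = Finset.univ ∨
    ∃ a b : Fin n, (a ≤ b ∧ I = Finset.Icc a b) ∨ (b < a ∧ I = Finset.Ici a ∪ Finset.Iic b)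

end Screw

theorem take_mergeSort_aux {α : Type*} (le : α → α → Bool)
    (htr : ∀ a b c, le a b = true → le b c = true → le a c = true)
    (htot : ∀ a b, (le a b || le b a) = true)
    (hanti : ∀ a b, le a b = true → le b a = true → a = b)
    (l : List α) (r : ℕ) (a b : α) (ha : a ∈ (l.mergeSort le).take r)
    (hb : b ∈ l) (hba : le b a = true) : b ∈ (l.mergeSort le).take r := by
  have hp := List.pairwise_mergeSort htr htot l
  have hb' : b ∈ l.mergeSort le := List.mem_mergeSort.2 hb
  rw [← List.take_append_drop r (l.mergeSort le)] at hp hb'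
  rw [List.pairwise_append] at hp
  rcases List.mem_append.1 hb' with h | h
  · exact h
  · have := hanti a b (hp.2.2 a ha b h) hba
    exact this ▸ ha

open Screw in
/-- The GM-move preserves monotonicity. -/
theorem gmMove_monotone (n k ℓ : ℕ) (hk : 0 < k) (hkn : k < n) (hℓ : 1 < ℓ)
    (x : Fin n → ℤ) (hx : Monotone x) :
    Monotone (gmMove k ℓ x) := by
  intro i j hij
  have hle := hx hij
  have key : x i = x j → i ∈ bearSet k ℓ x → j ∈ bearSet k ℓ x := by
    intro he hi
    have hM : i ∈ mulSet ℓ x ↔ j ∈ mulSet ℓ x := by simp [mulSet, he]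
    unfold bearSet at hi ⊢
    dsimp only at hi ⊢
    split_ifs at hi ⊢ with hc
    · rw [List.mem_toFinset] at hi ⊢
      have hiM : i ∈ mulSet ℓ x :=
        Finset.mem_toList.1 (List.mem_mergeSort.1 (List.mem_of_mem_take hi))
      refine take_mergeSort_aux _ ?_ ?_ ?_ _ _ i j hi (Finset.mem_toList.2 (hM.1 hiM)) ?_
      · intro a b c; simp only [tieLE, decide_eq_true_eq]; omega
      · intro a b; simp only [tieLE, Bool.or_eq_true, decide_eq_true_eq]; omega
      · intro a b; simp only [tieLE, decide_eq_true_eq]; omega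
      · simp only [tieLE, decide_eq_true_eq]; omega
    · rw [Finset.mem_union] at hi ⊢
      by_cases hiM : i ∈ mulSet ℓ x
      · exact Or.inl (hM.1 hiM)
      · right
        have hi := hi.resolve_left hiM
        rw [List.mem_toFinset] at hi ⊢
        have hjM : j ∉ mulSet ℓ x := fun h => hiM (hM.2 h)
        refine take_mergeSort_aux _ ?_ ?_ ?_ _ _ i j hi
          (Finset.mem_toList.2 (by simp [hjM])) ?_
        · intro a b c; simp only [decide_eq_true_eq]; omega
        · intro a b; simp only [Bool.or_eq_true, decide_eq_true_eq]; omega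
        · intro a b; simp only [decide_eq_true_eq]; omega
        · simpa using hij
  simp only [gmMove]
  split_ifs with h1 h2
  · exact hle
  · have : x i ≠ x j := fun h => h2 (key h h1)
    omega
  · omega
  · omega
end

section
/- Along any GM-sequence x⁰ → x¹ → ⋯ (where x^{j+1} = G(x^j)), the inequality m(x^j) ≥ n−k holds for every j ≥ (ℓ−1)·(n−k−m(x⁰)). In particular, if m(x⁰) < n−k, then the condition m(x^j) ≥ n−k is reached after at most (ℓ−1)·(n−k−m(x⁰)) GM-moves and holds from then on. -/
namespace Screw

lemma bear_lt {n k ℓ : ℕ} {x : Fin n → ℤ} (h : mcount ℓ x < n - k) :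
    bearSet k ℓ x = mulSet ℓ x ∪ (((Finset.univ \ mulSet ℓ x).toList.mergeSort
      (fun i j => decide (j ≤ i))).take (n - k - (mulSet ℓ x).card)).toFinset := by
  unfold bearSet
  unfold mcount at h
  simp only
  rw [if_neg (by omega)]

lemma mem_mulSet {n ℓ : ℕ} {x : Fin n → ℤ} {i : Fin n} :
    i ∈ mulSet ℓ x ↔ (ℓ : ℤ) ∣ x i := by
  simp [mulSet]

lemma gm_pos {n k ℓ : ℕ} {x : Fin n → ℤ} {i : Fin n} (h : i ∈ bearSet k ℓ x) :
    gmMove k ℓ x i = x i := if_pos h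

lemma gm_neg {n k ℓ : ℕ} {x : Fin n → ℤ} {i : Fin n} (h : i ∉ bearSet k ℓ x) :
    gmMove k ℓ x i = x i - 1 := if_neg h

lemma step_D {n k ℓ c : ℕ} {x : Fin n → ℤ} (hc : c ≤ n - k) (h : c ≤ mcount ℓ x) :
    c ≤ mcount ℓ (gmMove k ℓ x) := by
  have key : ∀ i, i ∈ bearSet k ℓ x → i ∈ mulSet ℓ x → i ∈ mulSet ℓ (gmMove k ℓ x) := by
    intro i hi hM
    rw [mem_mulSet] at hM ⊢
    rwa [gm_pos hi]
  by_cases hm : mcount ℓ x < n - k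
  · refine h.trans (Finset.card_le_card fun i hi => key i ?_ hi)
    rw [bear_lt hm]
    exact Finset.mem_union_left _ hi
  · have hb : bearSet k ℓ x =
        (((mulSet ℓ x).toList.mergeSort (tieLE x)).take (n - k)).toFinset := by
      unfold bearSet
      unfold mcount at hm
      simp only
      rw [if_pos (by omega)]
    have hcard : (bearSet k ℓ x).card = n - k := by
      rw [hb, List.toFinset_card_of_nodup]
      · simp only [List.length_take, List.length_mergeSort, Finset.length_toList]
        unfold mcount at hm
        omega
      · refine List.Nodup.sublist (List.take_sublist _ _) ?_
        exact (List.mergeSort_perm _ _).nodup_iff.2 (Finset.nodup_toList _)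
    rw [← hcard] at hc
    refine hc.trans (Finset.card_le_card fun i hi => key i hi ?_)
    rw [hb, List.mem_toFinset] at hi
    simpa using List.mem_of_mem_take hi

lemma iter_D {n k ℓ c : ℕ} {x : Fin n → ℤ} (hc : c ≤ n - k) (h : c ≤ mcount ℓ x) (i : ℕ) :
    c ≤ mcount ℓ ((gmMove k ℓ)^[i] x) := by
  induction i with
  | zero => exact h
  | succ i ih => rw [Function.iterate_succ_apply']; exact step_D hc ih

lemma step_C {n k ℓ : ℕ} (hk : 0 < k) (hkn : k < n) (hℓ : 1 < ℓ) {x : Fin n → ℤ}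
    (h : mcount ℓ x < n - k) :
    mcount ℓ x + 1 ≤ mcount ℓ ((gmMove k ℓ)^[ℓ - 1] x) := by
  suffices hs : ∃ i, i ≤ ℓ - 1 ∧ mcount ℓ x + 1 ≤ mcount ℓ ((gmMove k ℓ)^[i] x) by
    obtain ⟨i, hi, hm⟩ := hs
    have := iter_D (k := k) (by omega) hm (ℓ - 1 - i)
    rwa [← Function.iterate_add_apply, Nat.sub_add_cancel hi] at this
  by_contra! hno
  have inv : ∀ i, i ≤ ℓ - 1 → mulSet ℓ ((gmMove k ℓ)^[i] x) = mulSet ℓ x ∧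
      ∀ q, q ∉ bearSet k ℓ x → (gmMove k ℓ)^[i] x q = x q - i := by
    intro i
    induction i with
    | zero => intro _; simp
    | succ i ih =>
      intro hi
      obtain ⟨h1, h2⟩ := ih (by omega)
      have hmi : mcount ℓ ((gmMove k ℓ)^[i] x) < n - k := by
        unfold mcount at h ⊢; rwa [h1]
      have hb : bearSet k ℓ ((gmMove k ℓ)^[i] x) = bearSet k ℓ x := by
        rw [bear_lt hmi, bear_lt h, h1]
      have hno' := hno (i + 1) hi
      rw [Function.iterate_succ_apply'] at hno' ⊢
      constructor
      · symm
        apply Finset.eq_of_subset_of_card_le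
        · intro q hq
          have hqb : q ∈ bearSet k ℓ ((gmMove k ℓ)^[i] x) := by
            rw [hb, bear_lt h]; exact Finset.mem_union_left _ hq
          rw [← h1] at hq
          rw [mem_mulSet] at hq ⊢
          rwa [gm_pos hqb]
        · unfold mcount at hno'; omega
      · intro q hq
        rw [gm_neg (by rw [hb]; exact hq), h2 q hq]; push_cast; ring
  have hcard : (bearSet k ℓ x).card < n := by
    rw [bear_lt h]
    refine lt_of_le_of_lt (Finset.card_union_le _ _) ?_
    refine lt_of_le_of_lt (Nat.add_le_add_left (List.toFinset_card_le _) _) ?_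
    rw [List.length_take]
    unfold mcount at h
    omega
  obtain ⟨p, hp⟩ : ∃ p, p ∉ bearSet k ℓ x := by
    by_contra! hall
    rw [Finset.eq_univ_of_forall hall] at hcard
    simp at hcard
  have hpM : p ∉ mulSet ℓ x := fun hq => hp (by
    rw [bear_lt h]; exact Finset.mem_union_left _ hq)
  have h0 : 0 ≤ x p % (ℓ : ℤ) := Int.emod_nonneg _ (by omega)
  have h1 : x p % (ℓ : ℤ) < ℓ := Int.emod_lt_of_pos _ (by omega)
  obtain ⟨a, b⟩ := inv (x p % (ℓ : ℤ)).toNat (by omega)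
  apply hpM
  rw [← a]
  simp only [mulSet, Finset.mem_filter, Finset.mem_univ, true_and]
  rw [b p hp, Int.toNat_of_nonneg h0]
  exact Int.dvd_self_sub_emod

lemma main_aux {n k ℓ : ℕ} (hk : 0 < k) (hkn : k < n) (hℓ : 1 < ℓ) (d : ℕ) :
    ∀ (x : Fin n → ℤ) (j : ℕ), n - k ≤ mcount ℓ x + d → (ℓ - 1) * d ≤ j →
    n - k ≤ mcount ℓ ((gmMove k ℓ)^[j] x) := by
  induction d with
  | zero => intro x j h _; exact iter_D le_rfl h j
  | succ d ih =>
    intro x j h hj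
    by_cases hm : mcount ℓ x < n - k
    · have hC := step_C hk hkn hℓ hm
      rw [Nat.mul_succ] at hj
      have := ih ((gmMove k ℓ)^[ℓ - 1] x) (j - (ℓ - 1)) (by omega) (by omega)
      rwa [← Function.iterate_add_apply, Nat.sub_add_cancel (by omega)] at this
    · exact iter_D le_rfl (by omega) j

end Screw

open Screw in
/-- Along any GM-sequence, `m(x^j) ≥ n - k` holds for every
`j ≥ (ℓ - 1) * (n - k - m(x⁰))`. -/
theorem mcount_ge_of_many_moves (n k ℓ : ℕ) (hk : 0 < k) (hkn : k < n) (hℓ : 1 < ℓ)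
    (x₀ : Fin n → ℤ) (hx : Monotone x₀) (j : ℕ)
    (hj : (ℓ - 1) * (n - k - mcount ℓ x₀) ≤ j) :
    n - k ≤ mcount ℓ ((gmMove k ℓ)^[j] x₀) := by
  exact main_aux hk hkn hℓ _ x₀ j (by omega) hj
end

section
/- The GM-move preserves the inequality range(x) ≤ ℓ on positions with enough multiples of ℓ: if x is a position with m(x) ≥ n−k and range(x) ≤ ℓ, then range(G(x)) ≤ ℓ. -/
open Screw in
/-- The GM-move preserves the inequality `range(x) ≤ ℓ` on positions
with at least `n - k` entries that are multiples of `ℓ`. -/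
theorem gmMove_preserves_range (n k ℓ : ℕ) (hk : 0 < k) (hkn : k < n) (hℓ : 1 < ℓ)
    (x : Fin n → ℤ) (hx : Monotone x) (hm : n - k ≤ mcount ℓ x)
    (hr : rangeOf x ≤ (ℓ : ℤ)) :
    rangeOf (gmMove k ℓ x) ≤ (ℓ : ℤ) := by
  have hn : 0 < n := by omega
  unfold rangeOf at hr ⊢
  rw [dif_pos hn] at hr ⊢
  generalize (⟨n - 1, by omega⟩ : Fin n) = b at hr ⊢
  generalize (⟨0, hn⟩ : Fin n) = a at hr ⊢
  by_contra hcon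
  have key : b ∈ bearSet k ℓ x ∧ a ∉ bearSet k ℓ x ∧ x b - x a = ℓ := by
    unfold gmMove at hcon
    by_cases h1 : b ∈ bearSet k ℓ x <;> by_cases h2 : a ∈ bearSet k ℓ x <;>
      simp only [h1, h2, if_true, if_false] at hcon <;>
      first
      | (exfalso; omega)
      | exact ⟨h1, h2, by omega⟩
  obtain ⟨hb, ha, he⟩ := key
  have hbs : bearSet k ℓ x
      = (((mulSet ℓ x).toList.mergeSort (tieLE x)).take (n - k)).toFinset := by
    unfold bearSet
    exact if_pos hm
  rw [hbs, List.mem_toFinset] at ha hb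
  have hbM : (ℓ : ℤ) ∣ x b := by
    have := List.mem_of_mem_take hb
    simpa [mulSet] using this
  have haM : (ℓ : ℤ) ∣ x a := by
    have : x a = x b - ℓ := by omega
    rw [this]
    exact dvd_sub hbM (dvd_refl _)
  have hal : a ∈ (mulSet ℓ x).toList.mergeSort (tieLE x) := by
    simpa [mulSet] using haM
  have hs : ((mulSet ℓ x).toList.mergeSort (tieLE x)).Pairwise (fun i j => tieLE x i j) := by
    apply List.pairwise_mergeSort
    · intro i j l h1 h2
      simp only [tieLE, decide_eq_true_eq] at *
      omega
    · intro i j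
      simp only [tieLE, Bool.or_eq_true, decide_eq_true_eq]
      omega
  rw [← List.take_append_drop (n - k) ((mulSet ℓ x).toList.mergeSort (tieLE x))] at hal hs
  have had := (List.mem_append.1 hal).resolve_left ha
  have := (List.pairwise_append.1 hs).2.2 b hb a had
  simp only [tieLE, decide_eq_true_eq] at this
  omega
end

section
/- If x is a position with m(x) ≥ n−k and range(x) ≤ ℓ, then the set M(x) of indices whose entries are multiples of ℓ is a cyclic interval of {1,…,n}. -/
open Screw in
/-- In the periodic regime, the set `M(x)` of indices whose entries are
multiples of `ℓ` is a cyclic interval. -/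
theorem mulSet_isCyclicInterval (n k ℓ : ℕ) (hk : 0 < k) (hkn : k < n) (hℓ : 1 < ℓ)
    (x : Fin n → ℤ) (hx : Monotone x) (hm : n - k ≤ mcount ℓ x)
    (hr : rangeOf x ≤ (ℓ : ℤ)) :
    IsCyclicInterval (mulSet ℓ x) := by
  have hn : 0 < n := by omega
  have mem : ∀ i, i ∈ mulSet ℓ x ↔ (ℓ : ℤ) ∣ x i := fun i => by simp [mulSet]
  rcases (mulSet ℓ x).eq_empty_or_nonempty with he | hne
  · exact Or.inl he
  right; right
  have hamem := (mem _).1 ((mulSet ℓ x).min'_mem hne)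
  have hbmem := (mem _).1 ((mulSet ℓ x).max'_mem hne)
  have hmin : ∀ i, i ∈ mulSet ℓ x → (mulSet ℓ x).min' hne ≤ i :=
    fun i hi => Finset.min'_le _ i hi
  have hmax : ∀ i, i ∈ mulSet ℓ x → i ≤ (mulSet ℓ x).max' hne :=
    fun i hi => Finset.le_max' _ i hi
  have hab : (mulSet ℓ x).min' hne ≤ (mulSet ℓ x).max' hne :=
    hmin _ ((mulSet ℓ x).max'_mem hne)
  generalize (mulSet ℓ x).min' hne = a at *
  generalize (mulSet ℓ x).max' hne = b at *
  have hxab := hx hab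
  rcases hxab.eq_or_lt with heq | hlt
  · refine ⟨a, b, Or.inl ⟨hab, ?_⟩⟩
    ext i
    rw [Finset.mem_Icc]
    constructor
    · exact fun hi => ⟨hmin i hi, hmax i hi⟩
    · rintro ⟨h1, h2⟩
      have h3 := hx h1
      have h4 := hx h2
      have : x i = x a := by omega
      rw [mem, this]; exact hamem
  · simp only [rangeOf, hn, dite_true] at hr
    have h0 : ∀ i, x ⟨0, hn⟩ ≤ x i := fun i => hx (Fin.mk_le_of_le_val (Nat.zero_le _))
    have h1 : ∀ i, x i ≤ x ⟨n - 1, by omega⟩ := fun i => hx (by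
      rw [Fin.le_def]; have := i.2; simp only; omega)
    generalize hz : (⟨0, hn⟩ : Fin n) = z at *
    generalize hw : (⟨n - 1, by omega⟩ : Fin n) = w at *
    have hd : (ℓ : ℤ) ≤ x b - x a := Int.le_of_dvd (by omega) (dvd_sub hbmem hamem)
    have e1 : x a = x z := by have := h0 a; have := h1 b; omega
    have e2 : x b = x w := by have := h0 a; have := h1 b; omega
    have hS : (Finset.univ.filter (fun i => x i = x b)).Nonempty := ⟨b, by simp⟩
    have hT : (Finset.univ.filter (fun i => x i = x a)).Nonempty := ⟨a, by simp⟩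
    obtain ⟨a', ha', hamin⟩ := Finset.exists_min_image _ id hS
    obtain ⟨b', hb', hbmax⟩ := Finset.exists_max_image _ id hT
    simp only [Finset.mem_filter, Finset.mem_univ, true_and, id] at ha' hb' hamin hbmax
    refine ⟨a', b', Or.inr ⟨?_, ?_⟩⟩
    · by_contra hc
      have := hx (not_lt.1 hc)
      omega
    · ext i
      rw [Finset.mem_union, Finset.mem_Ici, Finset.mem_Iic, mem]
      have u1 := h0 i
      have u2 := h1 i
      constructor
      · intro hi
        rcases u1.eq_or_lt with h | h
        · exact Or.inr (hbmax i (by omega))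
        · left
          apply hamin
          have := Int.le_of_dvd (by omega) (dvd_sub hi hamem)
          omega
      · rintro (h | h)
        · have := hx h
          have : x i = x b := by omega
          rw [this]; exact hbmem
        · have := hx h
          have : x i = x a := by omega
          rw [this]; exact hamem
end

section
/- If x is a position with m(x) ≥ n−k and range(x) ≤ ℓ, then the bear set P(x) is a cyclic interval of {1,…,n} (and hence so is the complementary set of k bulls). -/
namespace Screw

theorem bear_sub {n : ℕ} (k ℓ : ℕ) (x : Fin n → ℤ) (hm : n - k ≤ mcount ℓ x) :
    (∀ i ∈ bearSet k ℓ x, (ℓ : ℤ) ∣ x i) ∧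
    ∀ i j, j ∈ bearSet k ℓ x → (ℓ : ℤ) ∣ x i → (x i < x j ∨ (x i = x j ∧ j ≤ i)) →
      i ∈ bearSet k ℓ x := by
  have hb : bearSet k ℓ x =
      (((mulSet ℓ x).toList.mergeSort (tieLE x)).take (n - k)).toFinset := by
    unfold mcount at hm
    simp only [bearSet, hm, if_true]
  have hs : ((mulSet ℓ x).toList.mergeSort (tieLE x)).Pairwise (fun a b => tieLE x a b) := by
    apply List.pairwise_mergeSort
    · intro a b c h1 h2
      simp only [tieLE, decide_eq_true_eq] at *
      omega
    · intro a b
      simp only [tieLE, Bool.or_eq_true, decide_eq_true_eq] at *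
      omega
  have hmem : ∀ i, i ∈ (mulSet ℓ x).toList.mergeSort (tieLE x) ↔ (ℓ : ℤ) ∣ x i := by
    intro i
    simp [List.mem_mergeSort, mulSet]
  rw [hb]
  generalize (mulSet ℓ x).toList.mergeSort (tieLE x) = L at *
  refine ⟨fun i hi => (hmem i).1 (List.mem_of_mem_take (List.mem_toFinset.1 hi)), ?_⟩
  intro i j hj hi hij
  rw [List.mem_toFinset] at *
  have hiL := (hmem i).2 hi
  rw [← List.take_append_drop (n - k) L] at hs hiL
  rcases List.mem_append.1 hiL with h | h
  · exact h
  · have h2 := (List.pairwise_append.1 hs).2.2 j hj i h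
    simp only [tieLE, decide_eq_true_eq] at h2
    have : i = j := by omega
    rw [this]; exact hj

end Screw

open Screw in
/-- In the periodic regime, the bear set `P(x)` is a cyclic interval. -/
theorem bearSet_isCyclicInterval (n k ℓ : ℕ) (hk : 0 < k) (hkn : k < n) (hℓ : 1 < ℓ)
    (x : Fin n → ℤ) (hx : Monotone x) (hm : n - k ≤ mcount ℓ x)
    (hr : rangeOf x ≤ (ℓ : ℤ)) :
    IsCyclicInterval (bearSet k ℓ x) := by
  obtain ⟨hM, hD⟩ := bear_sub k ℓ x hm
  generalize bearSet k ℓ x = P at *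
  have hn : 0 < n := by omega
  rw [rangeOf, dif_pos hn] at hr
  have h0 : ∀ i, x ⟨0, hn⟩ ≤ x i := fun i => hx (Fin.mk_le_of_le_val (Nat.zero_le _))
  have h1 : ∀ i, x i ≤ x ⟨n - 1, by omega⟩ := fun i => hx (by
    rw [Fin.le_def]; have := i.2; simp only; omega)
  rcases P.eq_empty_or_nonempty with he | hne
  · exact Or.inl he
  right; right
  have key : ∀ i j, (ℓ : ℤ) ∣ x i → (ℓ : ℤ) ∣ x j → x i < x j →
      x i = x ⟨0, hn⟩ ∧ x j = x ⟨0, hn⟩ + ℓ := by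
    intro i j hi hj hij
    have := Int.le_of_dvd (by omega) (Int.dvd_sub hj hi)
    have := h0 i
    have := h1 j
    omega
  by_cases hc : ∃ i ∈ P, ∃ j ∈ P, x i < x j
  · obtain ⟨i, hi, j, hj, hij⟩ := hc
    obtain ⟨ki, kj⟩ := key i j (hM i hi) (hM j hj) hij
    have hA : (P.filter (fun p => x p = x i)).Nonempty := ⟨i, by simp [hi]⟩
    have hB : (P.filter (fun p => x p = x j)).Nonempty := ⟨j, by simp [hj]⟩
    obtain ⟨b, hb, hbm⟩ := Finset.exists_max_image _ id hA
    obtain ⟨a, ha, ham⟩ := Finset.exists_min_image _ id hB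
    simp only [Finset.mem_filter, id, and_imp] at hb hbm ha ham
    have hba : b < a := by
      by_contra h
      have := hx (not_lt.1 h)
      omega
    refine ⟨a, b, Or.inr ⟨hba, ?_⟩⟩
    ext p
    simp only [Finset.mem_union, Finset.mem_Ici, Finset.mem_Iic]
    constructor
    · intro hp
      by_cases hpi : x p = x i
      · exact Or.inr (hbm p hp hpi)
      · have : x i < x p := lt_of_le_of_ne (by rw [ki]; exact h0 p) (Ne.symm hpi)
        have := key i p (hM i hi) (hM p hp) this
        exact Or.inl (ham p hp (by omega))
    · rintro (h | h)
      · have e : x p = x a := by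
          have := hx h
          have := h1 p
          omega
        exact hD p a ha.1 (e ▸ hM a ha.1) (Or.inr ⟨e, h⟩)
      · have e : x p = x b := by
          have := hx h
          have := h0 p
          omega
        exact hD p j hj (e ▸ hM b hb.1) (Or.inl (by omega))
  · push Not at hc
    obtain ⟨b, hb, hbm⟩ := Finset.exists_max_image _ id hne
    obtain ⟨a, ha, ham⟩ := Finset.exists_min_image _ id hne
    simp only [id] at hbm ham
    refine ⟨a, b, Or.inl ⟨ham b hb, ?_⟩⟩
    ext p
    rw [Finset.mem_Icc]
    constructor
    · exact fun hp => ⟨ham p hp, hbm p hp⟩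
    · rintro ⟨h, h'⟩
      have e : x p = x a := by
        have := hx h
        have := hx h'
        have := hc a ha b hb
        have := hc b hb a ha
        omega
      exact hD p a ha (e ▸ hM a ha) (Or.inr ⟨e, h⟩)
end

section
/- Main Lemma (screw rotation): let x be a position with m(x) ≥ n−k and range(x) ≤ ℓ, and let G^ℓ(x) denote the result of ℓ consecutive GM-moves applied to x. Then for every index i ∈ {1,…,n}: i is a bear in x (i.e., i ∈ P(x)) if and only if σ(i) is a bear in G^ℓ(x) (i.e., σ(i) ∈ P(G^ℓ(x))), where σ(i) = ((i + k − 1) mod n) + 1 is the cyclic shift of i by k. In other words, ℓ GM-moves shift the interval of n−k bears (and the complementary interval of k bulls) by k to the right in the cyclic order on {1,…,n}. -/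
namespace Screw

lemma bear_spec {n k ℓ : ℕ} (x : Fin n → ℤ) (h : n - k ≤ (mulSet ℓ x).card) :
    bearSet k ℓ x ⊆ mulSet ℓ x ∧ (bearSet k ℓ x).card = n - k ∧
    ∀ a ∈ bearSet k ℓ x, ∀ b ∈ mulSet ℓ x, b ∉ bearSet k ℓ x → tieLE x a b = true := by
  have hb : bearSet k ℓ x = (((mulSet ℓ x).toList.mergeSort (tieLE x)).take (n - k)).toFinset := by
    unfold bearSet; simp only [if_pos h]
  have hperm := List.mergeSort_perm (mulSet ℓ x).toList (tieLE x)
  have hsort : List.Pairwise (fun a b => tieLE x a b = true)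
      ((mulSet ℓ x).toList.mergeSort (tieLE x)) := by
    apply List.pairwise_mergeSort
    · intro a b c; simp only [tieLE, decide_eq_true_eq]; intro h1 h2
      rcases h1 with h1 | ⟨h1, h1'⟩ <;> rcases h2 with h2 | ⟨h2, h2'⟩
      · left; omega
      · left; omega
      · left; omega
      · right; exact ⟨by omega, le_trans h2' h1'⟩
    · intro a b
      simp only [tieLE, Bool.or_eq_true, decide_eq_true_eq]
      have := le_total a b
      rcases lt_trichotomy (x a) (x b) with h | h | h
      · left; left; exact h
      · rcases this with t | t
        · right; right; exact ⟨h.symm, t⟩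
        · left; right; exact ⟨h, t⟩
      · right; left; exact h
  rw [hb]
  generalize (mulSet ℓ x).toList.mergeSort (tieLE x) = L at *
  have hmem : ∀ a, a ∈ L ↔ a ∈ mulSet ℓ x := fun a => by rw [hperm.mem_iff]; simp
  have hnd : L.Nodup := hperm.nodup_iff.2 (Finset.nodup_toList _)
  have hlen : L.length = (mulSet ℓ x).card := by rw [hperm.length_eq]; simp
  refine ⟨?_, ?_, ?_⟩
  · intro a ha
    exact (hmem a).1 (List.mem_of_mem_take (List.mem_toFinset.1 ha))
  · rw [List.toFinset_card_of_nodup (hnd.sublist (List.take_sublist _ _)), List.length_take]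
    omega
  · intro a ha b hbM hbn
    rw [List.mem_toFinset] at ha hbn
    rw [← List.take_append_drop (n-k) L, List.pairwise_append] at hsort
    refine hsort.2.2 a ha b ?_
    have := (hmem b).2 hbM
    rw [← List.take_append_drop (n-k) L, List.mem_append] at this
    tauto

/-- Quasi-periodic extension. -/
def Y {n : ℕ} (hn : 0 < n) (ℓ : ℕ) (x : Fin n → ℤ) (j : ℤ) : ℤ :=
  x ⟨(j % n).toNat, by
    have := Int.emod_nonneg j (b := n) (by omega)
    have := Int.emod_lt_of_pos j (b := n) (by omega)
    omega⟩ + ℓ * (j / n)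

lemma Y_add {n : ℕ} (hn : 0 < n) (ℓ : ℕ) (x : Fin n → ℤ) (j s : ℤ) :
    Y hn ℓ x (j + n * s) = Y hn ℓ x j + ℓ * s := by
  unfold Y
  have h0 : (n : ℤ) ≠ 0 := by omega
  simp only [Int.add_mul_emod_self_left, Int.add_mul_ediv_left _ _ h0]
  ring

lemma Y_fin {n : ℕ} (hn : 0 < n) (ℓ : ℕ) (x : Fin n → ℤ) (i : Fin n) :
    Y hn ℓ x (i.val : ℤ) = x i := by
  unfold Y
  have h1 : ((i.val : ℤ) % n) = i.val := Int.emod_eq_of_lt (by omega) (by omega)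
  have h2 : ((i.val : ℤ) / n) = 0 := Int.ediv_eq_zero_of_lt (by omega) (by omega)
  simp [h1, h2]

def IsE {n : ℕ} (hn : 0 < n) (k ℓ : ℕ) (x : Fin n → ℤ) (e : ℤ) : Prop :=
  (∀ j, e - n + k < j → j ≤ e → Y hn ℓ x j = 0) ∧ ∀ j, e < j → 0 < Y hn ℓ x j

/-- lift of an index to the window ending at e -/
lemma lift_spec {n : ℕ} (hn : 0 < n) (ℓ : ℕ) (x : Fin n → ℤ) (e : ℤ) (i : Fin n) :
    ∃ a : ℤ, e - (e - i.val) % n = i.val + n * a ∧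
      Y hn ℓ x (e - (e - i.val) % n) = x i + ℓ * a := by
  refine ⟨(e - i.val) / n, ?_, ?_⟩
  · have := Int.emod_add_mul_ediv (e - i.val) n
    linarith
  · rw [← Y_fin hn ℓ x i, ← Y_add]
    congr 1
    have := Int.emod_add_mul_ediv (e - i.val) n
    linarith

lemma bear_iff {n k ℓ : ℕ} (hk : 0 < k) (hkn : k < n) (hℓ : 1 < ℓ) (hn : 0 < n)
    (x : Fin n → ℤ) (e : ℤ) (hY : Monotone (Y hn ℓ x)) (hE : IsE hn k ℓ x e) (i : Fin n) :
    i ∈ bearSet k ℓ x ↔ (e - i.val) % n < n - k := by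
  classical
  let B : Finset (Fin n) := Finset.univ.filter (fun i => (e - i.val) % n < n - k)
  have hBM : B ⊆ mulSet ℓ x := by
    intro i hi
    simp only [B, Finset.mem_filter, Finset.mem_univ, true_and] at hi
    simp only [mulSet, Finset.mem_filter, Finset.mem_univ, true_and]
    obtain ⟨a, h1, h2⟩ := lift_spec hn ℓ x e i
    have h0 := Int.emod_nonneg (e - i.val) (b := n) (by omega)
    rw [hE.1 _ (by omega) (by omega)] at h2
    exact ⟨-a, by linarith⟩
  have hBc : B.card = n - k := by
    have : B.card = (Finset.range (n - k)).card := by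
      symm
      refine Finset.card_bij (fun t _ => (⟨((e - t) % n).toNat, by
        have := Int.emod_nonneg (e - t) (b := n) (by omega)
        have := Int.emod_lt_of_pos (e - t) (b := n) (by omega)
        omega⟩ : Fin n)) ?_ ?_ ?_
      · intro t ht
        simp only [Finset.mem_range] at ht
        simp only [B, Finset.mem_filter, Finset.mem_univ, true_and]
        have := Int.emod_nonneg (e - t) (b := n) (by omega)
        rw [Int.toNat_of_nonneg this, Int.sub_emod, Int.emod_emod, ← Int.sub_emod]
        rw [show e - (e - t) = (t : ℤ) by ring, Int.emod_eq_of_lt (by omega) (by omega)]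
        omega
      · intro t ht s hs h
        simp only [Finset.mem_range] at ht hs
        simp only [Fin.mk.injEq] at h
        have h1 := Int.emod_nonneg (e - t) (b := n) (by omega)
        have h2 := Int.emod_nonneg (e - s) (b := n) (by omega)
        have h3 : (e - t) % n = (e - s) % n := by omega
        have h4 : (n : ℤ) ∣ (t : ℤ) - s := by
          have := Int.dvd_of_emod_eq_zero (Int.emod_eq_emod_iff_emod_sub_eq_zero.1 h3.symm)
          rwa [show (e - s) - (e - t) = (t : ℤ) - s by ring] at this
        have := Int.eq_zero_of_abs_lt_dvd h4 (by rw [abs_lt]; constructor <;> omega)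
        omega
      · intro b hb
        simp only [B, Finset.mem_filter, Finset.mem_univ, true_and] at hb
        have h0 := Int.emod_nonneg (e - b.val) (b := n) (by omega)
        refine ⟨((e - b.val) % n).toNat, by simp only [Finset.mem_range]; omega, ?_⟩
        ext
        simp only
        rw [Int.toNat_of_nonneg h0, Int.sub_emod, Int.emod_emod, ← Int.sub_emod]
        rw [show e - (e - b.val) = (b.val : ℤ) by ring, Int.emod_eq_of_lt (by omega) (by omega)]
        omega
    simpa using this
  have hcard : n - k ≤ (mulSet ℓ x).card := hBc ▸ Finset.card_le_card hBM
  obtain ⟨hs1, hs2, hs3⟩ := bear_spec (k := k) x hcard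
  have hB3 : ∀ a ∈ B, ∀ b ∈ mulSet ℓ x, b ∉ B → x a < x b ∨ (x a = x b ∧ b < a) := by
    intro a ha b hb hbB
    simp only [B, Finset.mem_filter, Finset.mem_univ, true_and] at ha hbB
    simp only [mulSet, Finset.mem_filter, Finset.mem_univ, true_and] at hb
    obtain ⟨p, h1, h2⟩ := lift_spec hn ℓ x e a
    obtain ⟨q, h3, h4⟩ := lift_spec hn ℓ x e b
    have h0 := Int.emod_nonneg (e - a.val) (b := n) (by omega)
    have h0' := Int.emod_lt_of_pos (e - b.val) (b := n) (by omega)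
    rw [hE.1 _ (by omega) (by omega)] at h2
    obtain ⟨c, hc⟩ := hb
    have hpos : (0 : ℤ) < ℓ := by omega
    have hnpos : (0 : ℤ) < n := by omega
    have h00 := Int.emod_nonneg (e - b.val) (b := n) (by omega)
    have hYe : Y hn ℓ x e = 0 := hE.1 e (by omega) le_rfl
    have u1 : (ℓ : ℤ) * (c + q) ≤ 0 := by
      have := hY (show e - (e - b.val) % n ≤ e by omega)
      rw [h4, hYe] at this
      linarith
    have u2 : 0 < (ℓ : ℤ) * (c + q + 1) := by
      have := hE.2 ((e - (e - b.val) % n) + n * 1) (by omega)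
      rw [Y_add, h4] at this
      linarith
    have u3 : c + q ≤ 0 := by
      by_contra hh
      have : (ℓ : ℤ) * 1 ≤ ℓ * (c + q) := mul_le_mul_of_nonneg_left (by omega) hpos.le
      omega
    have u4 : 0 < c + q + 1 := pos_of_mul_pos_right u2 hpos.le
    have hcq : c = - q := by omega
    subst hcq
    have u5 : (b.val : ℤ) + n * q < a.val + n * p := by omega
    have u6 : q ≤ p := by
      by_contra hh
      have : (n : ℤ) * (p + 1) ≤ n * q := mul_le_mul_of_nonneg_left (by omega) hnpos.le
      have := a.isLt
      linarith
    rcases u6.lt_or_eq with u6 | u6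
    · left
      have : (ℓ : ℤ) * q < ℓ * p := mul_lt_mul_of_pos_left u6 hpos
      linarith
    · right
      subst u6
      exact ⟨by linarith, by rw [Fin.lt_def]; omega⟩
  have hBeq : B = bearSet k ℓ x := by
    apply Finset.eq_of_subset_of_card_le _ (by omega)
    intro b hb
    by_contra hbn
    have : ¬ bearSet k ℓ x ⊆ B := by
      intro hsub
      have := Finset.eq_of_subset_of_card_le hsub (by omega)
      rw [this] at hbn; exact hbn hb
    obtain ⟨c, hc, hcB⟩ := Finset.not_subset.1 this
    have t1 := hB3 b hb c (hs1 hc) hcB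
    have t2 := hs3 c hc b (hBM hb) hbn
    simp only [tieLE, decide_eq_true_eq] at t2
    rcases t1 with t1 | ⟨t1, t1'⟩ <;> rcases t2 with t2 | ⟨t2, t2'⟩ <;> try omega
  rw [← hBeq]
  simp [B]


lemma Y_move {n k ℓ : ℕ} (hk : 0 < k) (hkn : k < n) (hℓ : 1 < ℓ) (hn : 0 < n)
    (x : Fin n → ℤ) (e : ℤ) (hY : Monotone (Y hn ℓ x)) (hE : IsE hn k ℓ x e) (j : ℤ) :
    Y hn ℓ (gmMove k ℓ x) j = Y hn ℓ x j - if (e - j) % n < n - k then 0 else 1 := by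
  have h0 := Int.emod_nonneg j (b := n) (by omega)
  unfold Y gmMove
  have hh : (e - j % n) % n = (e - j) % n := by
    rw [Int.sub_emod, Int.emod_emod, ← Int.sub_emod]
  simp only [bear_iff hk hkn hℓ hn x e hY hE, Int.toNat_of_nonneg h0, hh]
  split_ifs <;> ring

lemma exists_max {n ℓ : ℕ} (hn : 0 < n) (hℓ : 1 < ℓ) (x : Fin n → ℤ)
    (hY : Monotone (Y hn ℓ x)) (e : ℤ) (he : Y hn ℓ x e = 0) :
    ∃ e', e ≤ e' ∧ Y hn ℓ x e' = 0 ∧ ∀ j, e' < j → 0 < Y hn ℓ x j := by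
  obtain ⟨e', h1, h2⟩ := Int.exists_greatest_of_bdd (P := fun j => Y hn ℓ x j ≤ 0)
    ⟨e + n * 1, fun z hz => by
      by_contra hh
      have := hY (show e + n * 1 ≤ z by omega)
      rw [Y_add, he] at this
      omega⟩ ⟨e, he.le⟩
  have h3 := h2 e he.le
  refine ⟨e', h3, le_antisymm h1 (he ▸ hY h3), fun j hj => ?_⟩
  by_contra hh
  have := h2 j (by omega)
  omega

lemma step {n k ℓ : ℕ} (hk : 0 < k) (hkn : k < n) (hℓ : 1 < ℓ) (hn : 0 < n)
    (x : Fin n → ℤ) (e : ℤ) (hY : Monotone (Y hn ℓ x)) (hE : IsE hn k ℓ x e) :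
    Monotone (Y hn ℓ (gmMove k ℓ x)) ∧ ∃ e', e ≤ e' ∧ IsE hn k ℓ (gmMove k ℓ x) e' := by
  have hYe : Y hn ℓ x e = 0 := hE.1 e (by omega) le_rfl
  have hM : Monotone (Y hn ℓ (gmMove k ℓ x)) := by
    apply monotone_int_of_le_succ
    intro j
    rw [Y_move hk hkn hℓ hn x e hY hE, Y_move hk hkn hℓ hn x e hY hE]
    have h1 := hY (show j ≤ j + 1 by omega)
    by_cases hj : (e - j) % n = 0
    · obtain ⟨s, hs⟩ := Int.dvd_of_emod_eq_zero hj
      have h2 := hE.2 (e + 1) (by omega)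
      have h3 := Y_add hn ℓ x j s
      have h4 := Y_add hn ℓ x (j + 1) s
      rw [show j + n * s = e by linarith] at h3
      rw [show j + 1 + n * s = e + 1 by linarith] at h4
      split_ifs <;> linarith
    · have : (e - (j + 1)) % n = (e - j) % n - 1 := by
        have h5 := Int.emod_nonneg (e - j) (b := n) (by omega)
        have h6 := Int.emod_lt_of_pos (e - j) (b := n) (by omega)
        rw [show e - (j + 1) = (e - j) - 1 by ring, Int.sub_emod, ← Int.emod_emod (e - j) n,
          ← Int.sub_emod, Int.emod_emod]
        exact Int.emod_eq_of_lt (by omega) (by omega)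
      rw [this]
      split_ifs <;> omega
  refine ⟨hM, ?_⟩
  have hb : ∀ j, e - n + k < j → j ≤ e → Y hn ℓ (gmMove k ℓ x) j = 0 := by
    intro j h1 h2
    rw [Y_move hk hkn hℓ hn x e hY hE, hE.1 j h1 h2, Int.emod_eq_of_lt (by omega) (by omega),
      if_pos (by omega)]
    rfl
  obtain ⟨e', h1, h2, h3⟩ := exists_max hn hℓ _ hM e (hb e (by omega) le_rfl)
  refine ⟨e', h1, ?_, h3⟩
  intro j h4 h5
  rcases le_or_gt j e with h6 | h6
  · exact hb j (by omega) h6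
  · apply le_antisymm
    · rw [← h2]; exact hM h5
    · rw [← hb e (by omega) le_rfl]; exact hM h6.le

lemma init {n k ℓ : ℕ} (hkn : k < n) (hℓ : 1 < ℓ) (hn : 0 < n)
    (x : Fin n → ℤ) (hx : Monotone x) (hm : n - k ≤ mcount ℓ x)
    (hr : rangeOf x ≤ (ℓ : ℤ)) :
    Monotone (Y hn ℓ x) ∧ ∃ e, IsE hn k ℓ x e := by
  have hM : Monotone (Y hn ℓ x) := by
    apply monotone_int_of_le_succ
    intro j
    have h0 := Int.emod_nonneg j (b := n) (by omega)
    have h1 := Int.emod_lt_of_pos j (b := n) (by omega)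
    have h2 := Int.emod_add_mul_ediv j n
    obtain ⟨r, hr'⟩ := Int.eq_ofNat_of_zero_le h0
    generalize j / n = s at *
    rw [hr'] at h1 h2
    have hrn : r < n := by omega
    have e1 : Y hn ℓ x j = x ⟨r, hrn⟩ + ℓ * s := by
      rw [← h2, Y_add, ← Y_fin hn ℓ x ⟨r, hrn⟩]
    rw [e1]
    by_cases hlast : r + 1 < n
    · have e2 : Y hn ℓ x (j + 1) = x ⟨r + 1, hlast⟩ + ℓ * s := by
        rw [← Y_fin hn ℓ x ⟨r + 1, hlast⟩, ← Y_add]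
        congr 1
        push_cast
        linarith
      rw [e2]
      have := hx (show (⟨r, hrn⟩ : Fin n) ≤ ⟨r + 1, hlast⟩ by simp)
      linarith
    · have e2 : Y hn ℓ x (j + 1) = x ⟨0, hn⟩ + ℓ * (s + 1) := by
        rw [← Y_fin hn ℓ x ⟨0, hn⟩, ← Y_add]
        congr 1
        have : (r : ℤ) + 1 = n := by omega
        push_cast
        linarith
      rw [e2]
      unfold rangeOf at hr
      rw [dif_pos hn] at hr
      have : x ⟨r, hrn⟩ ≤ x ⟨n - 1, by omega⟩ := hx (by rw [Fin.le_def]; simp; omega)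
      linarith
  refine ⟨hM, ?_⟩
  have hne : (mulSet ℓ x).Nonempty := by
    rw [← Finset.card_pos]
    unfold mcount at hm
    omega
  obtain ⟨i0, hi0⟩ := hne
  simp only [mulSet, Finset.mem_filter, Finset.mem_univ, true_and] at hi0
  obtain ⟨c, hc⟩ := hi0
  obtain ⟨e, -, he, he2⟩ := exists_max hn hℓ x hM (i0.val + n * (-c)) (by
    rw [Y_add, Y_fin, hc]; ring)
  refine ⟨e, ?_, he2⟩
  intro j0 hj1 hj2
  by_contra hne
  have hlt : Y hn ℓ x j0 < 0 := lt_of_le_of_ne (he ▸ hM hj2) hne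
  have hpos : (0 : ℤ) < ℓ := by omega
  have : (mulSet ℓ x).card ≤ (Finset.Ioc j0 e).card := by
    refine Finset.card_le_card_of_injOn (fun i => e - (e - i.val) % n) ?_ ?_
    · intro i hi
      simp only [mulSet, Finset.coe_filter, Finset.mem_univ, true_and, Set.mem_ofPred_eq] at hi
      obtain ⟨d, hd⟩ := hi
      have h0 := Int.emod_nonneg (e - i.val) (b := n) (by omega)
      have h1 := Int.emod_lt_of_pos (e - i.val) (b := n) (by omega)
      simp only [Finset.coe_Ioc, Set.mem_Ioc]
      refine ⟨?_, by omega⟩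
      by_contra hh
      obtain ⟨a, -, h4⟩ := lift_spec hn ℓ x e i
      have u1 := hM (not_lt.1 hh)
      have u2 := he2 ((e - (e - i.val) % n) + n * 1) (by omega)
      rw [Y_add] at u2
      rw [h4, hd] at u1 u2
      have u3 : 0 < (ℓ : ℤ) * (d + a + 1) := by linarith
      have u4 := pos_of_mul_pos_right u3 hpos.le
      have u5 : 0 ≤ (ℓ : ℤ) * (d + a) := mul_nonneg hpos.le (by omega)
      linarith
    · intro i _ i' _ h
      simp only at h
      have h3 : (e - i.val) % n = (e - i'.val) % n := by omega
      have := Int.dvd_of_emod_eq_zero (Int.emod_eq_emod_iff_emod_sub_eq_zero.1 h3)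
      have := Int.eq_zero_of_abs_lt_dvd this (by rw [abs_lt]; constructor <;> omega)
      ext
      omega
  rw [Int.card_Ioc] at this
  unfold mcount at hm
  omega

lemma iter {n k ℓ : ℕ} (hk : 0 < k) (hkn : k < n) (hℓ : 1 < ℓ) (hn : 0 < n)
    (x : Fin n → ℤ) (e : ℤ) (hY : Monotone (Y hn ℓ x)) (hE : IsE hn k ℓ x e) (t : ℕ) :
    Monotone (Y hn ℓ ((gmMove k ℓ)^[t] x)) ∧ ∃ e', e ≤ e' ∧
      IsE hn k ℓ ((gmMove k ℓ)^[t] x) e' ∧ (t = 0 → e' = e) ∧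
      (∀ j, e' < j → j ≤ e + k → Y hn ℓ ((gmMove k ℓ)^[t] x) j = Y hn ℓ x j - t) ∧
      ℓ - t + (if t = 0 then 0 else 1) ≤ Y hn ℓ ((gmMove k ℓ)^[t] x) (e + k + 1) := by
  induction t with
  | zero =>
    refine ⟨hY, e, le_rfl, hE, fun _ => rfl, by simp, ?_⟩
    have := Y_add hn ℓ x (e + k + 1 - n) 1
    rw [hE.1 (e + k + 1 - n) (by omega) (by omega), show e + k + 1 - n + (n : ℤ) * 1 = e + k + 1 by ring] at this
    simp [this]
  | succ t ih =>
    obtain ⟨hM, e1, h1, h2, h3, h4, h5⟩ := ih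
    rw [Function.iterate_succ_apply']
    generalize (gmMove k ℓ)^[t] x = z at *
    obtain ⟨hM', e2, g1, g2⟩ := step hk hkn hℓ hn z e1 hM h2
    refine ⟨hM', e2, by omega, g2, by omega, ?_, ?_⟩
    · intro j hj1 hj2
      rw [Y_move hk hkn hℓ hn z e1 hM h2, h4 j (by omega) hj2]
      have : (e1 - j) % n = e1 - j + n := by
        rw [← Int.add_emod_right]
        exact Int.emod_eq_of_lt (by omega) (by omega)
      rw [this, if_neg (by omega)]
      push_cast; ring
    · rw [Y_move hk hkn hℓ hn z e1 hM h2]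
      by_cases ht : t = 0
      · have he := h3 ht
        subst he
        have : (e1 - (e1 + k + 1)) % n = n - k - 1 := by
          rw [← Int.add_emod_right, show e1 - (e1 + k + 1) + n = (n - k - 1 : ℤ) by ring]
          exact Int.emod_eq_of_lt (by omega) (by omega)
        have hlt : (e1 - (e1 + k + 1)) % n < (n : ℤ) - k := by omega
        rw [if_pos hlt]
        subst ht
        simpa using h5
      · rw [if_neg ht] at h5
        rw [if_neg (by omega)]
        push_cast
        split_ifs <;> linarith

end Screw

open Screw in
/-- Main Lemma, screw rotation: `ℓ` GM-moves shift the interval of bears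
by `k` to the right in the cyclic order: `i` is a bear in `x` iff the cyclic shift of `i`
by `k` is a bear in `G^ℓ(x)`. -/
theorem main_lemma (n k ℓ : ℕ) (hk : 0 < k) (hkn : k < n) (hℓ : 1 < ℓ)
    (x : Fin n → ℤ) (hx : Monotone x) (hm : n - k ≤ mcount ℓ x)
    (hr : rangeOf x ≤ (ℓ : ℤ)) (i : Fin n) :
    i ∈ bearSet k ℓ x ↔
      (⟨(i.val + k) % n, Nat.mod_lt _ (by omega)⟩ : Fin n) ∈
        bearSet k ℓ ((gmMove k ℓ)^[ℓ] x) := by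
  have hn : 0 < n := by omega
  obtain ⟨hY, e, hE⟩ := init hkn hℓ hn x hx hm hr
  obtain ⟨hM, e', h1, h2, -, h4, h5⟩ := iter hk hkn hℓ hn x e hY hE ℓ
  have hYe : Y hn ℓ x e = 0 := hE.1 e (by omega) le_rfl
  have a1 : e + k ≤ e' := by
    by_contra hh
    have u1 := h4 (e + k) (by omega) le_rfl
    have u2 := h2.2 (e + k) (by omega)
    have u3 := hY (show e + k ≤ e + n * 1 by omega)
    rw [Y_add, hYe] at u3
    linarith
  have a2 : e' ≤ e + k := by
    by_contra hh
    have u1 := hM (show e + k + 1 ≤ e' by omega)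
    rw [h2.1 e' (by omega) le_rfl] at u1
    rw [if_neg (by omega)] at h5
    linarith
  have a3 : e' = e + k := by omega
  rw [bear_iff hk hkn hℓ hn x e hY hE, bear_iff hk hkn hℓ hn _ e' hM h2, a3]
  simp only
  push_cast
  rw [show (e + k - ((i.val : ℤ) + k) % n) % n = (e - i.val) % n by
    rw [Int.sub_emod, Int.emod_emod, ← Int.sub_emod]
    congr 1
    ring]
end

section
/- Main Theorem (screw periodicity): let p = ℓ·n / gcd(n,k) and δ = p·k/n = ℓ·k / gcd(n,k). If x is a position with m(x) ≥ n−k and range(x) ≤ ℓ, then after p GM-moves every entry decreases by exactly δ: for every i ∈ {1,…,n}, x_i − (G^p(x))_i = δ, where G^p(x) denotes the result of p consecutive GM-moves applied to x. -/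
namespace Screw

theorem take_sorted_eq {α : Type*} [DecidableEq α] (le : α → α → Bool) (L : List α)
    (hs : L.Pairwise (fun a b => le a b = true)) (hn : L.Nodup) (B : Finset α) (c : ℕ)
    (hc : B.card = c) (hB : ∀ b ∈ B, b ∈ L)
    (h : ∀ b ∈ B, ∀ m ∈ L, m ∉ B → ¬ (le m b = true)) : (L.take c).toFinset = B := by
  have hlen : c ≤ L.length := by
    have : B ⊆ L.toFinset := fun b hb => by simpa using hB b hb
    have := Finset.card_le_card this
    rw [List.toFinset_card_of_nodup hn] at this
    omega
  have hcard : (L.take c).toFinset.card = c := by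
    rw [List.toFinset_card_of_nodup (hn.sublist (List.take_sublist _ _))]
    simp [hlen]
  symm
  apply Finset.eq_of_subset_of_card_le _ (by omega)
  intro b hb
  by_contra hbS
  obtain ⟨s, hsS, hsB⟩ : ∃ s ∈ (L.take c).toFinset, s ∉ B := by
    by_contra hcon
    push Not at hcon
    have := Finset.eq_of_subset_of_card_le (s := (L.take c).toFinset) (t := B) hcon (by omega)
    rw [this] at hbS
    exact hbS hb
  have hbL := hB b hb
  rw [List.mem_toFinset] at hsS hbS
  rw [← List.take_append_drop c L] at hs hbL
  have hbD : b ∈ L.drop c := (List.mem_append.1 hbL).resolve_left hbS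
  exact h b hb s (List.mem_of_mem_take hsS) hsB ((List.pairwise_append.1 hs).2.2 s hsS b hbD)

theorem modFin {n : ℕ} (hn : 0 < n) (j : ℤ) : ∃ i : Fin n, ∃ q : ℤ, j = i + n * q := by
  have h0 : (0:ℤ) < n := by exact_mod_cast hn
  have h1 := Int.emod_nonneg j h0.ne'
  have h2 := Int.emod_lt_of_pos j h0
  refine ⟨⟨(j % n).toNat, by omega⟩, j / n, ?_⟩
  have := Int.emod_add_mul_ediv j n
  simp only
  omega

theorem qle {n : ℕ} {q q' : ℤ} (h : (n:ℤ) * q < n * q' + n) : q ≤ q' := by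
  by_contra hc
  have : q' + 1 ≤ q := by omega
  nlinarith

theorem mulmono {n : ℕ} {q q' : ℤ} (h : q < q') : (n:ℤ) * q + n ≤ n * q' := by
  have : q + 1 ≤ q' := by omega
  nlinarith

theorem bear_iff_s10 (n k ℓ : ℕ) (hk : 0 < k) (hkn : k < n)
    (x : Fin n → ℤ) (e e' : ℤ) (h1 : ∀ (i : Fin n) (q : ℤ), x i ≤ ℓ * q ↔ (i : ℤ) ≤ e + n * q)
    (h2 : ∀ (i : Fin n) (q : ℤ), x i ≤ ℓ * q + (ℓ - 1) ↔ (i : ℤ) ≤ e' + n * q)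
    (he : e' ≤ e + k) (i : Fin n) :
    i ∈ bearSet k ℓ x ↔ ∃ q : ℤ, x i = ℓ * q ∧ e + n * q - (n - k) < i ∧ (i : ℤ) ≤ e + n * q := by
  classical
  have h0 : (0:ℤ) < n := by omega
  have hx : ∀ (i : Fin n) (q : ℤ), e + n * q - (n - k) < i → (i : ℤ) ≤ e + n * q → x i = ℓ * q := by
    intro i q ha hb
    have := (h1 i q).2 hb
    have h3 := (h2 i (q-1)).not.2 (by rw [mul_sub]; omega)
    rw [mul_sub] at h3
    omega
  set B : Finset (Fin n) := Finset.univ.filter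
    (fun i => ∃ q : ℤ, x i = ℓ * q ∧ e + n * q - (n - k) < i ∧ (i : ℤ) ≤ e + n * q) with hBdef
  have hBmem : ∀ i, i ∈ B ↔ ∃ q : ℤ, x i = ℓ * q ∧ e + n * q - (n - k) < i ∧ (i : ℤ) ≤ e + n * q := by
    intro i; simp [hBdef]
  have hBcard : B.card = n - k := by
    have hI : (Finset.Ioc (e - (n - k)) e).card = n - k := by
      rw [Int.card_Ioc]; omega
    rw [← hI]
    symm
    choose f hf using modFin (n := n) (by omega)
    choose g hg using hf
    refine Finset.card_bij (fun j _ => f j) ?_ ?_ ?_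
    · intro j hj
      rw [Finset.mem_Ioc] at hj
      have hh := hg j
      rw [hBmem]
      have e1 : e + n * (- g j) - (n - k) < f j := by rw [mul_neg]; omega
      have e2 : (f j : ℤ) ≤ e + n * (- g j) := by rw [mul_neg]; omega
      exact ⟨- g j, hx _ _ e1 e2, e1, e2⟩
    · intro j hj j' hj' hff
      rw [Finset.mem_Ioc] at hj hj'
      have a := hg j
      have b := hg j'
      rw [hff] at a
      have c1 : g j ≤ g j' := qle (n := n) (by omega)
      have c2 : g j' ≤ g j := qle (n := n) (by omega)
      have : g j = g j' := by omega
      rw [this] at a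
      omega
    · intro i hi
      obtain ⟨q, -, ha, hb⟩ := (hBmem i).1 hi
      refine ⟨i - n * q, by rw [Finset.mem_Ioc]; omega, ?_⟩
      have a := hg (i - n * q)
      have l1 := (f (i - n * q)).2
      have l2 := i.2
      have c1 : g (i - n * q) ≤ -q := qle (n := n) (by rw [mul_neg]; omega)
      have c2 : -q ≤ g (i - n * q) := qle (n := n) (by rw [mul_neg]; omega)
      have : g (i - n * q) = -q := by omega
      rw [this, mul_neg] at a
      apply Fin.ext
      omega
  have hBM : B ⊆ mulSet ℓ x := by
    intro i hi
    obtain ⟨q, hq, -⟩ := (hBmem i).1 hi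
    simp only [mulSet, Finset.mem_filter, Finset.mem_univ, true_and]
    exact ⟨q, hq⟩
  have hcM : n - k ≤ (mulSet ℓ x).card := hBcard ▸ Finset.card_le_card hBM
  rw [← hBmem]
  have : bearSet k ℓ x = B := by
    unfold bearSet
    simp only [hcM, if_true]
    apply take_sorted_eq (tieLE x) _ _ _ B _ hBcard
    · intro b hb
      simpa using hBM hb
    · intro b hb m hm hmB
      have hm : m ∈ mulSet ℓ x := by simpa using hm
      simp only [mulSet, Finset.mem_filter, Finset.mem_univ, true_and] at hm
      obtain ⟨q', hq'⟩ := hm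
      obtain ⟨q, hq, ha, hb'⟩ := (hBmem b).1 hb
      have m1 := (h1 m q').1 hq'.le
      have m2 : (m : ℤ) ≤ e + n * q' - (n - k) := by
        by_contra hc
        exact hmB ((hBmem m).2 ⟨q', hq', by omega, m1⟩)
      have l1 := b.2
      have l2 := m.2
      unfold tieLE
      simp only [decide_eq_true_eq]
      rintro (hlt | ⟨heq, hle⟩)
      · rw [hq, hq'] at hlt
        have : q' < q := by
          by_contra hc
          have : (ℓ:ℤ) * q ≤ ℓ * q' := mul_le_mul_of_nonneg_left (by omega) (by positivity)
          omega
        have := mulmono (n := n) this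
        omega
      · have := (h1 b q').1 (by rw [← heq, hq'])
        have := (h1 m q).1 (by rw [heq, hq])
        have hle' : (b:ℤ) ≤ m := by exact_mod_cast hle
        have c1 : q ≤ q' := by
          by_contra hc
          have := mulmono (n := n) (lt_of_not_ge hc)
          omega
        have := mul_le_mul_of_nonneg_left c1 h0.le
        have c2 : q' = q := by
          by_contra hc
          have hlt : q < q' := by omega
          have hz : (ℓ:ℤ) * q = ℓ * q' := by rw [← hq, ← hq', heq]
          have hℓ : (ℓ:ℤ) = 0 := by
            have : (ℓ:ℤ) * (q' - q) = 0 := by rw [mul_sub]; omega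
            rcases mul_eq_zero.1 this with h | h <;> omega
          have h5 : (b:ℤ) ≤ e + n * (q - 1) := (h1 b (q-1)).1 (by rw [hq, hℓ]; simp)
          have h6 : (m:ℤ) ≤ e + n * (q - 1) := (h1 m (q-1)).1 (by rw [← heq.symm, hq, hℓ]; simp)
          rw [mul_sub] at h5
          omega
        rw [c2] at m2
        omega
    · apply List.pairwise_mergeSort
      · intro a b c
        simp only [tieLE, decide_eq_true_eq]
        rintro (h | ⟨h, h'⟩) (g | ⟨g, g'⟩)
        · left; omega
        · left; omega
        · left; omega
        · right; exact ⟨h.trans g, g'.trans h'⟩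
      · intro a b
        simp only [tieLE, Bool.or_eq_true, decide_eq_true_eq]
        rcases lt_trichotomy (x a) (x b) with h | h | h
        · tauto
        · rcases le_total a b with g | g
          · right; right; exact ⟨h.symm, g⟩
          · left; right; exact ⟨h, g⟩
        · tauto
    · exact (List.mergeSort_perm _ _).nodup_iff.2 (Finset.nodup_toList _)
  rw [this]

/-- The relation between a position and the sequence `H` at time `T`. -/
def Rel {n : ℕ} (ℓ : ℕ) (H : ℕ → ℤ) (T : ℕ) (x : Fin n → ℤ) : Prop :=
  ∀ (i : Fin n) (q : ℤ) (r : ℕ), r < ℓ → (x i ≤ ℓ * q + r ↔ (i : ℤ) ≤ H (T + r) + n * q)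

theorem rel_step (n k ℓ : ℕ) (hk : 0 < k) (hkn : k < n) (hℓ : 1 < ℓ) (H : ℕ → ℤ)
    (hper : ∀ t, H (t + ℓ) = H t + k) (hmono : Monotone H) (T : ℕ)
    (x : Fin n → ℤ) (h : Rel ℓ H T x) : Rel ℓ H (T + 1) (gmMove k ℓ x) := by
  have hb := bear_iff_s10 n k ℓ hk hkn x (H T) (H (T + (ℓ - 1)))
    (fun i q => by simpa using h i q 0 (by omega))
    (fun i q => by
      have := h i q (ℓ - 1) (by omega)
      rw [← this]
      have : ((ℓ - 1 : ℕ) : ℤ) = ℓ - 1 := by omega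
      rw [this])
    (by rw [← hper]; exact hmono (by omega))
  intro i q r hr
  unfold gmMove
  have hl0 : (0:ℤ) < ℓ := by omega
  rcases Nat.lt_or_ge (r + 1) ℓ with hr1 | hr1
  · have h1 := h i q (r+1) hr1
    have hT : T + (r + 1) = T + 1 + r := by omega
    rw [hT] at h1
    rw [← h1]
    split_ifs with hi
    · obtain ⟨q', hq', -⟩ := (hb i).1 hi
      rw [hq']
      push_cast
      constructor
      · intro; omega
      · intro hh
        have : q' ≤ q := qle (n := ℓ) (by omega)
        have := mul_le_mul_of_nonneg_left this hl0.le
        omega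
    · push_cast; omega
  · have hT : T + 1 + r = T + ℓ := by omega
    rw [hT, hper]
    have h1 := h i (q + 1) 0 (by omega)
    rw [mul_add, mul_add] at h1
    simp only [Nat.cast_zero, add_zero, mul_one] at h1
    split_ifs with hi
    · obtain ⟨q', hq', ha, hc⟩ := (hb i).1 hi
      rw [hq']
      constructor
      · intro hh
        have : q' ≤ q := qle (n := ℓ) (by omega)
        have := mul_le_mul_of_nonneg_left this (Int.natCast_nonneg n)
        omega
      · intro hh
        have : q' ≤ q := qle (n := n) (by omega)
        have := mul_le_mul_of_nonneg_left this hl0.le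
        omega
    · constructor
      · intro hh
        have h2 := h1.1 (by omega)
        by_contra hc
        apply hi
        rw [hb]
        refine ⟨q + 1, ?_, by rw [mul_add]; omega, by rw [mul_add]; omega⟩
        have h3 := (h i q (ℓ - 1) (by omega)).not.2 (by
          have : H (T + (ℓ - 1)) ≤ H (T + ℓ) := hmono (by omega)
          rw [hper] at this
          omega)
        rw [mul_add]
        omega
      · intro hh
        have := h1.2 (by omega)
        omega

theorem rel_iter (n k ℓ : ℕ) (hk : 0 < k) (hkn : k < n) (hℓ : 1 < ℓ) (H : ℕ → ℤ)
    (hper : ∀ t, H (t + ℓ) = H t + k) (hmono : Monotone H)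
    (x : Fin n → ℤ) (h : Rel ℓ H 0 x) (T : ℕ) : Rel ℓ H T ((gmMove k ℓ)^[T] x) := by
  induction T with
  | zero => exact h
  | succ T ih =>
    rw [Function.iterate_succ_apply']
    exact rel_step n k ℓ hk hkn hℓ H hper hmono T _ ih

theorem exists_h (n ℓ : ℕ) (hn : 0 < n) (hℓ : 1 < ℓ)
    (x : Fin n → ℤ) (hx : Monotone x) (hr : rangeOf x ≤ (ℓ : ℤ)) :
    ∃ h : ℤ → ℤ, ∀ (i : Fin n) (q v : ℤ), x i + ℓ * q ≤ v ↔ (i:ℤ) + n * q ≤ h v := by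
  have hl0 : (0:ℤ) < ℓ := by omega
  have hn0 : (0:ℤ) < n := by omega
  simp only [rangeOf, hn, dif_pos] at hr
  have hrange : ∀ i j, x i ≤ x j + ℓ := by
    intro i j
    have a : x i ≤ x ⟨n - 1, by omega⟩ := hx (by rw [Fin.le_def]; simp only; omega)
    have b : x ⟨0, hn⟩ ≤ x j := hx (by rw [Fin.le_def]; simp only; omega)
    omega
  -- monotonicity of the extension
  have hmon : ∀ (i j : Fin n) (q q' : ℤ), (i:ℤ) + n * q ≤ j + n * q' → x i + ℓ * q ≤ x j + ℓ * q' := by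
    intro i j q q' hle
    have l1 := i.2
    have l2 := j.2
    have hq : q ≤ q' := qle (n := n) (by omega)
    rcases hq.lt_or_eq with h | h
    · have := mulmono (n := ℓ) h
      have := hrange i j
      omega
    · subst h
      have : x i ≤ x j := hx (by rw [Fin.le_def]; omega)
      omega
  have hv : ∀ v : ℤ, ∃ w : ℤ, ∀ (i : Fin n) (q : ℤ), x i + ℓ * q ≤ v ↔ (i:ℤ) + n * q ≤ w := by
    intro v
    obtain ⟨w, hw, hmax⟩ := Int.exists_greatest_of_bdd
      (P := fun j : ℤ => ∃ (i : Fin n) (q : ℤ), j = i + n * q ∧ x i + ℓ * q ≤ v)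
      (by
        refine ⟨n * (|v - x ⟨0,hn⟩| + 1), ?_⟩
        rintro z ⟨i, q, rfl, hz⟩
        have l1 := i.2
        have a : x ⟨0, hn⟩ ≤ x i := hx (by rw [Fin.le_def]; simp only; omega)
        have b : q ≤ |v - x ⟨0,hn⟩| := by
          have := le_abs_self (v - x ⟨0,hn⟩)
          have := abs_nonneg (v - x ⟨0,hn⟩)
          by_contra hc
          nlinarith
        have := mul_le_mul_of_nonneg_left b hn0.le
        rw [mul_add]
        omega)
      (by
        refine ⟨_, ⟨0, hn⟩, -|v - x ⟨0,hn⟩|, rfl, ?_⟩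
        have := neg_abs_le (v - x ⟨0,hn⟩)
        have := abs_nonneg (v - x ⟨0,hn⟩)
        nlinarith)
    refine ⟨w, fun i q => ⟨fun hh => hmax _ ⟨i, q, rfl, hh⟩, fun hh => ?_⟩⟩
    obtain ⟨j, q', rfl, hj⟩ := hw
    exact (hmon i j q q' hh).trans hj
  choose h hh using hv
  exact ⟨h, fun i q v => hh v i q⟩

theorem exists_H (n k ℓ : ℕ) (hkn : k < n) (hℓ : 1 < ℓ)
    (x : Fin n → ℤ) (hx : Monotone x) (hm : n - k ≤ mcount ℓ x) (hr : rangeOf x ≤ (ℓ : ℤ)) :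
    ∃ H : ℕ → ℤ, (∀ t, H (t + ℓ) = H t + k) ∧ Monotone H ∧ Rel ℓ H 0 x := by
  obtain ⟨h, hh⟩ := exists_h n ℓ (by omega) hℓ x hx hr
  have hmono : Monotone h := by
    intro v w hvw
    obtain ⟨i, q, hiq⟩ := modFin (n := n) (by omega) (h v)
    have := (hh i q v).2 hiq.ge
    have := (hh i q w).1 (by omega)
    omega
  have hshift : h (-1) = h (ℓ - 1) - n := by
    apply le_antisymm
    · obtain ⟨i, q, hiq⟩ := modFin (n := n) (by omega) (h (-1))
      have a := (hh i q _).2 hiq.ge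
      have := (hh i (q+1) (ℓ - 1)).1 (by rw [mul_add]; omega)
      rw [mul_add] at this
      omega
    · obtain ⟨i, q, hiq⟩ := modFin (n := n) (by omega) (h (ℓ - 1))
      have a := (hh i q _).2 hiq.ge
      have := (hh i (q-1) (-1)).1 (by rw [mul_sub]; omega)
      rw [mul_sub] at this
      omega
  have hkey : h (ℓ - 1) ≤ h 0 + k := by
    have hle : mcount ℓ x ≤ (Finset.Ioc (h (-1)) (h 0)).card := by
      unfold mcount
      have hd : ∀ i : Fin n, ∃ q : ℤ, i ∈ mulSet ℓ x → x i = ℓ * q := by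
        intro i
        by_cases hi : i ∈ mulSet ℓ x
        · simp only [mulSet, Finset.mem_filter, Finset.mem_univ, true_and] at hi
          obtain ⟨q, hq⟩ := hi
          exact ⟨q, fun _ => hq⟩
        · exact ⟨0, fun h => absurd h hi⟩
      choose g hg using hd
      apply Finset.card_le_card_of_injOn (fun i : Fin n => (i:ℤ) + n * (- g i))
      · intro i hi
        have hi' := hg i hi
        have a := (hh i (- g i) 0).1 (by rw [hi', mul_neg]; omega)
        have b := (hh i (- g i) (-1)).not.1 (by rw [hi', mul_neg]; omega)
        simp only [Finset.coe_Ioc, Set.mem_Ioc]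
        omega
      · intro i _ j _ hij
        simp only [mul_neg] at hij
        have l1 := i.2
        have l2 := j.2
        have c1 : g i ≤ g j := qle (n := n) (by omega)
        have c2 : g j ≤ g i := qle (n := n) (by omega)
        have : g i = g j := by omega
        rw [this] at hij
        apply Fin.ext
        omega
    rw [Int.card_Ioc] at hle
    omega
  have hl : 0 < ℓ := by omega
  refine ⟨fun t => h ((t % ℓ : ℕ)) + k * ((t / ℓ : ℕ) : ℤ), ?_, ?_, ?_⟩
  · intro t
    simp only [Nat.add_mod_right, Nat.add_div_right t hl]
    push_cast
    ring
  · apply monotone_nat_of_le_succ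
    intro t
    have hlt := Nat.mod_lt t hl
    have hdm := Nat.div_add_mod t ℓ
    rcases Nat.lt_or_ge (t % ℓ + 1) ℓ with hc | hc
    · have e : (t+1) % ℓ = t % ℓ + 1 ∧ (t+1) / ℓ = t / ℓ := by
        rw [and_comm, Nat.div_mod_unique hl]
        omega
      rw [e.1, e.2]
      have : h ((t % ℓ : ℕ)) ≤ h ((t % ℓ + 1 : ℕ)) := hmono (by omega)
      omega
    · have e : (t+1) % ℓ = 0 ∧ (t+1) / ℓ = t / ℓ + 1 := by
        rw [and_comm, Nat.div_mod_unique hl, mul_add]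
        omega
      rw [e.1, e.2]
      have : ((t % ℓ : ℕ) : ℤ) = ℓ - 1 := by omega
      rw [this]
      push_cast
      rw [mul_add]
      omega
  · intro i q r hr
    have := hh i (-q) r
    simp only [zero_add, Nat.mod_eq_of_lt hr, Nat.div_eq_of_lt hr]
    rw [mul_neg, mul_neg] at this
    push_cast
    omega

end Screw

open Screw in
/-- Main Theorem, screw periodicity: with `p = ℓ·n / gcd(n,k)` and
`δ = ℓ·k / gcd(n,k)`, after `p` GM-moves every entry decreases by exactly `δ`. -/
theorem main_theorem (n k ℓ : ℕ) (hk : 0 < k) (hkn : k < n) (hℓ : 1 < ℓ)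
    (x : Fin n → ℤ) (hx : Monotone x) (hm : n - k ≤ mcount ℓ x)
    (hr : rangeOf x ≤ (ℓ : ℤ)) (i : Fin n) :
    x i - (gmMove k ℓ)^[ℓ * n / Nat.gcd n k] x i = (ℓ * k / Nat.gcd n k : ℕ) := by
  obtain ⟨H, hper, hmono, h0⟩ := exists_H n k ℓ hkn hℓ x hx hm hr
  have hp := rel_iter n k ℓ hk hkn hℓ H hper hmono x h0 (ℓ * n / Nat.gcd n k)
  have hg : 0 < Nat.gcd n k := Nat.gcd_pos_of_pos_right n hk
  obtain ⟨a, ha⟩ := Nat.gcd_dvd_left n k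
  obtain ⟨b, hb⟩ := Nat.gcd_dvd_right n k
  have e1 : ℓ * n / Nat.gcd n k = ℓ * a := by
    rw [Nat.mul_div_assoc _ (Nat.gcd_dvd_left n k)]
    congr 1
    exact Nat.div_eq_of_eq_mul_right hg ha
  have e2 : ℓ * k / Nat.gcd n k = ℓ * b := by
    rw [Nat.mul_div_assoc _ (Nat.gcd_dvd_right n k)]
    congr 1
    exact Nat.div_eq_of_eq_mul_right hg hb
  have hab : (k:ℤ) * a = n * b := by
    have : k * a = n * b := by
      calc k * a = (Nat.gcd n k * b) * a := by rw [← hb]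
        _ = (Nat.gcd n k * a) * b := by ring
        _ = n * b := by rw [← ha]
    exact_mod_cast this
  rw [e1] at hp ⊢
  rw [e2]
  have hH : ∀ (c r : ℕ), H (ℓ * c + r) = H r + k * c := by
    intro c r
    induction c with
    | zero => simp
    | succ c ih =>
      have : ℓ * (c + 1) + r = ℓ * c + r + ℓ := by ring
      rw [this, hper, ih]
      push_cast
      ring
  have hl0 : (0:ℤ) < ℓ := by omega
  have key : ∀ v : ℤ, (gmMove k ℓ)^[ℓ * a] x i ≤ v ↔ x i ≤ v + ℓ * b := by
    intro v
    have hv := Int.emod_add_mul_ediv v ℓ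
    have hv1 := Int.emod_nonneg v hl0.ne'
    have hv2 := Int.emod_lt_of_pos v hl0
    obtain ⟨r, hr'⟩ := Int.eq_ofNat_of_zero_le hv1
    have hrl : r < ℓ := by omega
    have A := hp i (v / ℓ) r hrl
    have B := h0 i (v / ℓ + b) r hrl
    rw [hH, hab] at A
    rw [zero_add, mul_add, mul_add] at B
    have hv' : v = ℓ * (v / ℓ) + r := by omega
    have C : v + ℓ * b = ℓ * (v / ℓ) + ℓ * b + r := by omega
    rw [C, B]
    conv_lhs => rw [hv']
    rw [A]
    omega
  have k1 := (key _).1 le_rfl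
  have k2 := (key (x i - ℓ * b)).2 (by omega)
  push_cast
  omega
end

section
/- In the periodic regime, over one period each index is a bull the same number of times: let p = ℓ·n / gcd(n,k) and δ = p·k/n = ℓ·k / gcd(n,k). If x is a position with m(x) ≥ n−k and range(x) ≤ ℓ, then for every index i ∈ {1,…,n}, the number of t with 0 ≤ t < p such that i is a bull in G^t(x) (i.e., i ∉ P(G^t(x))) equals δ. -/
namespace Screw

lemma take_sort_eq {n : ℕ} (x : Fin n → ℤ) (M S : Finset (Fin n)) (hSM : S ⊆ M)
    (h : ∀ a ∈ S, ∀ c ∈ M, c ∉ S → tieLE x a c = true) :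
    ((M.toList.mergeSort (tieLE x)).take S.card).toFinset = S := by
  have hperm := List.mergeSort_perm M.toList (tieLE x)
  have hsort : List.Pairwise (fun a b => tieLE x a b = true) (M.toList.mergeSort (tieLE x)) := by
    apply List.pairwise_mergeSort
    · intro a b c
      simp only [tieLE, decide_eq_true_eq]
      omega
    · intro a b
      simp only [tieLE, Bool.or_eq_true, decide_eq_true_eq]
      omega
  generalize M.toList.mergeSort (tieLE x) = L at hperm hsort
  have hnd : L.Nodup := hperm.nodup_iff.2 M.nodup_toList
  have hmem : ∀ a, a ∈ L ↔ a ∈ M := fun a => by rw [hperm.mem_iff, Finset.mem_toList]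
  have hlen : L.length = M.card := by rw [hperm.length_eq, Finset.length_toList]
  have hcT : (L.take S.card).toFinset.card = S.card := by
    rw [List.toFinset_card_of_nodup (hnd.sublist (List.take_sublist _ _)), List.length_take, hlen]
    exact min_eq_left (Finset.card_le_card hSM)
  apply Finset.eq_of_subset_of_card_le _ hcT.ge
  by_contra hns
  rw [Finset.not_subset] at hns
  obtain ⟨c, hcT', hcS⟩ := hns
  have : ¬ S ⊆ (L.take S.card).toFinset := by
    intro hs
    have := Finset.eq_of_subset_of_card_le hs hcT.le
    exact hcS (this ▸ hcT')
  rw [Finset.not_subset] at this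
  obtain ⟨a, haS, haT⟩ := this
  rw [List.mem_toFinset] at hcT' haT
  have hcM : c ∈ M := (hmem c).1 (List.mem_of_mem_take hcT')
  have haL : a ∈ L := (hmem a).2 (hSM haS)
  have haD : a ∈ L.drop S.card := by
    rw [← List.take_append_drop S.card L, List.mem_append] at haL
    exact haL.resolve_left haT
  rw [← List.take_append_drop S.card L, List.pairwise_append] at hsort
  have h1 := hsort.2.2 c hcT' a haD
  have h2 := h a haS c hcM hcS
  simp only [tieLE, decide_eq_true_eq] at h1 h2
  have : a = c := by apply Fin.ext; omega
  exact hcS (this ▸ haS)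

/-- The invariant. -/
def Inv {n : ℕ} (ℓ : ℕ) (x : Fin n → ℤ) (b : ℕ → ℤ) : Prop :=
  ∀ (i : Fin n) (v : ℕ) (q : ℤ), v < ℓ → (x i ≤ v + ℓ * q ↔ ((i : ℕ) : ℤ) ≤ b v + n * q)

/-- The bears in terms of the right end. -/
def bset (n k : ℕ) (c : ℤ) : Finset (Fin n) :=
  Finset.univ.filter (fun i => (c - ((i : ℕ) : ℤ)) % n < n - k)

lemma mem_bset {n k : ℕ} (hkn : k < n) (c : ℤ) (i : Fin n) :
    i ∈ bset n k c ↔ ∃ q : ℤ, c + n * q + k - n < ((i : ℕ) : ℤ) ∧ ((i : ℕ) : ℤ) ≤ c + n * q := by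
  have hn : (0 : ℤ) < n := by omega
  simp only [bset, Finset.mem_filter, Finset.mem_univ, true_and]
  have h1 := Int.emod_nonneg (c - ((i : ℕ) : ℤ)) hn.ne'
  have h2 := Int.emod_add_mul_ediv (c - ((i : ℕ) : ℤ)) n
  constructor
  · intro h
    refine ⟨-((c - ((i : ℕ) : ℤ)) / n), ?_, ?_⟩ <;> rw [mul_neg] <;> linarith
  · rintro ⟨q, h3, h4⟩
    have : (c - ((i : ℕ) : ℤ)) % n = c - i + n * q := by
      rw [← Int.add_mul_emod_self_left _ _ q]
      apply Int.emod_eq_of_lt <;> omega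
    omega

lemma card_bset {n k : ℕ} (hkn : k < n) (c : ℤ) : (bset n k c).card = n - k := by
  have hn : (0 : ℤ) < n := by omega
  rw [← Finset.card_range (n - k)]
  apply Finset.card_nbij (fun i : Fin n => ((c - ((i : ℕ) : ℤ)) % n).toNat)
  · intro i hi
    simp only [bset, Finset.coe_filter, Finset.mem_univ, true_and, Set.mem_setOf_eq,
      Finset.mem_filter] at hi
    have h1 := Int.emod_nonneg (c - ((i : ℕ) : ℤ)) hn.ne'
    simp only [Finset.coe_range, Set.mem_Iio, Finset.mem_range]
    omega
  · intro i hi j hj hij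
    have h1 := Int.emod_nonneg (c - ((i : ℕ) : ℤ)) hn.ne'
    have h2 := Int.emod_nonneg (c - ((j : ℕ) : ℤ)) hn.ne'
    have h3 : (c - ((i : ℕ) : ℤ)) % n = (c - ((j : ℕ) : ℤ)) % n := by
      simp only at hij
      omega
    have h5 : (n : ℤ) ∣ (c - i) - (c - j) := Int.ModEq.dvd (h3.symm)
    have h6 : ((c - i) - (c - j) : ℤ) = 0 := by
      apply Int.eq_zero_of_abs_lt_dvd h5
      rw [abs_lt]
      have := i.2
      have := j.2
      constructor <;> omega
    apply Fin.ext
    omega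
  · intro r hr
    simp only [Finset.coe_range, Set.mem_Iio] at hr
    have h1 := Int.emod_nonneg (c - r) hn.ne'
    have h2 := Int.emod_lt_of_pos (c - r) hn
    have h3 := Int.emod_add_mul_ediv (c - r) n
    have key : (c - (c - r) % n) % n = r := by
      have : c - (c - r) % n = r + n * ((c - r) / n) := by linarith
      rw [this, Int.add_mul_emod_self_left]
      apply Int.emod_eq_of_lt <;> omega
    refine ⟨⟨((c - r) % n).toNat, by omega⟩, ?_, ?_⟩
    · simp only [bset, Finset.coe_filter, Finset.mem_univ, true_and, Set.mem_setOf_eq]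
      rw [Int.toNat_of_nonneg h1, key]
      omega
    · simp only
      rw [Int.toNat_of_nonneg h1, key]
      simp

lemma val_of_mul {n ℓ : ℕ} (hℓ : 1 < ℓ) {x : Fin n → ℤ} {b : ℕ → ℤ} (hI : Inv ℓ x b)
    (i : Fin n) (q : ℤ) :
    x i = ℓ * q ↔ (((i : ℕ) : ℤ) ≤ b 0 + n * q ∧ b (ℓ - 1) + n * q - n < ((i : ℕ) : ℤ)) := by
  have h1 := hI i 0 q (by omega)
  have h2 := hI i (ℓ - 1) (q - 1) (by omega)
  rw [mul_sub, mul_sub] at h2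
  push_cast [Nat.cast_sub hℓ.le] at h1 h2
  omega

lemma bear_eq {n k ℓ : ℕ} (hkn : k < n) (hℓ : 1 < ℓ) {x : Fin n → ℤ} {b : ℕ → ℤ}
    (hI : Inv ℓ x b) (hb : b (ℓ - 1) ≤ b 0 + k) (hb0 : b 0 ≤ b (ℓ - 1)) :
    bearSet k ℓ x = bset n k (b 0) ∧
      ∀ i ∈ bset n k (b 0), ∃ q : ℤ, x i = ℓ * q ∧
        b 0 + n * q + k - n < ((i : ℕ) : ℤ) ∧ ((i : ℕ) : ℤ) ≤ b 0 + n * q := by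
  have hv : ∀ i ∈ bset n k (b 0), ∃ q : ℤ, x i = ℓ * q ∧
        b 0 + n * q + k - n < ((i : ℕ) : ℤ) ∧ ((i : ℕ) : ℤ) ≤ b 0 + n * q := by
    intro i hi
    obtain ⟨q, h1, h2⟩ := (mem_bset hkn _ _).1 hi
    exact ⟨q, (val_of_mul hℓ hI i q).2 ⟨h2, by omega⟩, h1, h2⟩
  refine ⟨?_, hv⟩
  have hsub : bset n k (b 0) ⊆ mulSet ℓ x := by
    intro i hi
    obtain ⟨q, h, -⟩ := hv i hi
    simp [mulSet, h]
  have hc := card_bset hkn (b 0)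
  have hle := Finset.card_le_card hsub
  unfold bearSet
  simp only
  rw [if_pos (by omega), ← hc]
  apply take_sort_eq x _ _ hsub
  intro a ha c hc hcS
  obtain ⟨q, h1, h2, h3⟩ := hv a ha
  simp only [mulSet, Finset.mem_filter, Finset.mem_univ, true_and] at hc
  obtain ⟨q', hq'⟩ := hc
  obtain ⟨h4, h5⟩ := (val_of_mul hℓ hI c q').1 hq'
  have h6 : ((c : ℕ) : ℤ) ≤ b 0 + n * q' + k - n := by
    by_contra hh
    exact hcS ((mem_bset hkn _ _).2 ⟨q', by omega, h4⟩)
  simp only [tieLE, decide_eq_true_eq]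
  rw [h1, hq']
  have ha2 := a.2
  have hc2 := c.2
  rcases lt_trichotomy q q' with hlt | heq | hgt
  · left
    have : (0 : ℤ) < ℓ := by omega
    exact mul_lt_mul_of_pos_left hlt this
  · right
    subst heq
    refine ⟨rfl, ?_⟩
    rw [Fin.le_def]
    omega
  · exfalso
    have : (n : ℤ) * (q' + 1) ≤ n * q := mul_le_mul_of_nonneg_left (by omega) (by omega)
    rw [mul_add] at this
    omega

lemma step_s11 {n k ℓ : ℕ} (hkn : k < n) (hℓ : 1 < ℓ) {x : Fin n → ℤ} {b : ℕ → ℤ}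
    (hI : Inv ℓ x b) (hmono : Monotone b) (hper : ∀ v, b (v + ℓ) = b v + k) :
    Inv ℓ (gmMove k ℓ x) (fun v => b (v + 1)) := by
  have hp0 := hper 0
  rw [zero_add] at hp0
  have hm1 : b (ℓ - 1) ≤ b 0 + k := hp0 ▸ hmono (by omega)
  obtain ⟨hB, hv⟩ := bear_eq hkn hℓ hI hm1 (hmono (by omega))
  intro i v q hvl
  simp only [gmMove, hB]
  split_ifs with hi
  · obtain ⟨q0, h1, h2, h3⟩ := hv i hi
    have hb1 : b 0 ≤ b (v + 1) := hmono (by omega)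
    have hb2 : b (v + 1) ≤ b 0 + k := hp0 ▸ hmono (by omega)
    rw [h1]
    rcases le_or_gt q0 q with h | h
    · have e1 : (n : ℤ) * q0 ≤ n * q := mul_le_mul_of_nonneg_left h (by omega)
      have e2 : (ℓ : ℤ) * q0 ≤ ℓ * q := mul_le_mul_of_nonneg_left h (by omega)
      constructor <;> intro <;> omega
    · have e1 : (n : ℤ) * (q + 1) ≤ n * q0 := mul_le_mul_of_nonneg_left h (by omega)
      have e2 : (ℓ : ℤ) * (q + 1) ≤ ℓ * q0 := mul_le_mul_of_nonneg_left h (by omega)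
      rw [mul_add] at e1 e2
      constructor <;> intro <;> omega
  · by_cases hv1 : v + 1 < ℓ
    · have := hI i (v + 1) q hv1
      push_cast at this
      omega
    · have hvl' : v + 1 = ℓ := by omega
      have := hI i 0 (q + 1) (by omega)
      rw [hvl', hp0]
      rw [mul_add, mul_add] at this
      have hnb : ¬ (b 0 + n * (q + 1) + k - n < ((i : ℕ) : ℤ) ∧
          ((i : ℕ) : ℤ) ≤ b 0 + n * (q + 1)) :=
        fun h => hi ((mem_bset hkn _ _).2 ⟨_, h⟩)
      rw [mul_add] at hnb
      push_cast at this
      omega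

lemma iter_s11 {n k ℓ : ℕ} (hkn : k < n) (hℓ : 1 < ℓ) {x : Fin n → ℤ} {b : ℕ → ℤ}
    (hI : Inv ℓ x b) (hmono : Monotone b) (hper : ∀ v, b (v + ℓ) = b v + k) (t : ℕ) :
    Inv ℓ ((gmMove k ℓ)^[t] x) (fun v => b (v + t)) := by
  induction t with
  | zero => simpa using hI
  | succ t ih =>
    rw [Function.iterate_succ_apply']
    have := step_s11 hkn hℓ ih (fun a c h => hmono (by omega))
      (fun v => by rw [← hper]; congr 1; omega)
    convert this using 3
    omega

lemma count_eq {n : ℕ} (k ℓ : ℕ) (x : Fin n → ℤ) (i : Fin n) (t : ℕ) :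
    ((((Finset.range t).filter
        (fun t => i ∉ bearSet k ℓ ((gmMove k ℓ)^[t] x))).card : ℕ) : ℤ)
      = x i - (gmMove k ℓ)^[t] x i := by
  induction t with
  | zero => simp
  | succ t ih =>
    rw [Finset.range_add_one, Finset.filter_insert, Function.iterate_succ_apply']
    split_ifs with h
    · rw [ih]
      simp only [gmMove, if_pos h]
    · rw [Finset.card_insert_of_notMem (by simp)]
      push_cast
      rw [ih]
      simp only [gmMove, if_neg h]
      ring

lemma exists_b {n ℓ : ℕ} (hn : 0 < n) (hℓ : 1 < ℓ) (x : Fin n → ℤ) (hx : Monotone x)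
    (hr : rangeOf x ≤ (ℓ : ℤ)) (v : ℕ) :
    ∃ c : ℤ, ∀ (i : Fin n) (q : ℤ), (x i ≤ v + ℓ * q ↔ ((i : ℕ) : ℤ) ≤ c + n * q) := by
  have hrange : ∀ i j, x i - x j ≤ ℓ := by
    intro i j
    simp only [rangeOf, dif_pos hn] at hr
    have h1 : x i ≤ x ⟨n - 1, by omega⟩ := hx (by rw [Fin.le_def]; simp; omega)
    have h2 : x ⟨0, hn⟩ ≤ x j := hx (by rw [Fin.le_def]; simp)
    linarith
  have key : ∀ (i j : Fin n) (q r : ℤ), ((i : ℕ) : ℤ) - n * q ≤ ((j : ℕ) : ℤ) - n * r →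
      x i - ℓ * q ≤ x j - ℓ * r := by
    intro i j q r h
    have hi := i.2
    have hj := j.2
    rcases lt_trichotomy q r with hlt | heq | hgt
    · have : (n : ℤ) * (q + 1) ≤ n * r := mul_le_mul_of_nonneg_left (by omega) (by omega)
      rw [mul_add] at this
      omega
    · subst heq
      have : x i ≤ x j := hx (by rw [Fin.le_def]; omega)
      omega
    · have : (ℓ : ℤ) * (r + 1) ≤ ℓ * q := mul_le_mul_of_nonneg_left (by omega) (by omega)
      rw [mul_add] at this
      have := hrange i j
      omega
  let P : ℤ → Prop := fun j => ∃ (i : Fin n) (q : ℤ), j = ((i : ℕ) : ℤ) - n * q ∧ x i - ℓ * q ≤ v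
  let i0 : Fin n := ⟨0, hn⟩
  have hbd : ∃ B : ℤ, ∀ z, P z → z ≤ B := by
    refine ⟨((i0 : ℕ) : ℤ) - n * (-(|x i0| + v + 1)), ?_⟩
    rintro z ⟨i, q, rfl, h⟩
    by_contra hlt
    have h1 := key i0 i _ q (not_le.1 hlt).le
    have h2 := neg_abs_le (x i0)
    have h3 := abs_nonneg (x i0)
    have : (1 + |x i0| + v) * 2 ≤ (|x i0| + v + 1) * ℓ := by nlinarith
    nlinarith
  have hne : ∃ z, P z := by
    refine ⟨_, i0, |x i0|, rfl, ?_⟩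
    have h2 := le_abs_self (x i0)
    have h3 := abs_nonneg (x i0)
    nlinarith
  obtain ⟨c, ⟨i1, q1, hc, h1⟩, hmax⟩ := Int.exists_greatest_of_bdd hbd hne
  refine ⟨c, fun i q => ⟨fun h => ?_, fun h => ?_⟩⟩
  · have := hmax _ ⟨i, q, rfl, by linarith⟩
    linarith
  · have := key i i1 q q1 (by linarith)
    linarith

lemma exists_seq {n k ℓ : ℕ} (hkn : k < n) (hℓ : 1 < ℓ) (x : Fin n → ℤ) (hx : Monotone x)
    (hm : n - k ≤ mcount ℓ x) (hr : rangeOf x ≤ (ℓ : ℤ)) :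
    ∃ b : ℕ → ℤ, Inv ℓ x b ∧ Monotone b ∧ ∀ v, b (v + ℓ) = b v + k := by
  have hn : 0 < n := by omega
  choose c hc using exists_b hn hℓ x hx hr
  have hI : Inv ℓ x c := fun i v q _ => hc v i q
  have hcm : Monotone c := by
    intro v w hvw
    have h0 := Int.emod_nonneg (c v) (b := n) (by omega)
    have h1 := Int.emod_lt_of_pos (c v) (b := n) (by omega)
    have h2 := Int.emod_add_mul_ediv (c v) n
    have e1 := hc v ⟨(c v % n).toNat, by omega⟩ (-(c v / n))
    have e2 := hc w ⟨(c v % n).toNat, by omega⟩ (-(c v / n))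
    simp only [Int.toNat_of_nonneg h0, mul_neg] at e1 e2
    omega
  have hck : c (ℓ - 1) ≤ c 0 + k := by
    have hcard : (mulSet ℓ x).card ≤ (Finset.Ioc (c (ℓ - 1) - n) (c 0)).card := by
      apply Finset.card_le_card_of_injOn (fun i : Fin n => ((i : ℕ) : ℤ) - n * (x i / ℓ))
      · intro i hi
        simp only [mulSet, Finset.coe_filter, Finset.mem_univ, true_and, Set.mem_setOf_eq,
          Finset.mem_filter] at hi
        have := (val_of_mul hℓ hI i (x i / ℓ)).1 (Int.mul_ediv_cancel' hi).symm
        simp only [Finset.coe_Ioc, Set.mem_Ioc, Finset.mem_Ioc]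
        omega
      · intro i hi j hj hij
        simp only at hij
        have h5 : (n : ℤ) ∣ ((i : ℕ) : ℤ) - ((j : ℕ) : ℤ) :=
          ⟨x i / ℓ - x j / ℓ, by rw [mul_sub]; linarith⟩
        have h6 : (((i : ℕ) : ℤ) - ((j : ℕ) : ℤ)) = 0 := by
          apply Int.eq_zero_of_abs_lt_dvd h5
          rw [abs_lt]
          have := i.2
          have := j.2
          constructor <;> omega
        apply Fin.ext
        omega
    rw [Int.card_Ioc] at hcard
    unfold mcount at hm
    omega
  refine ⟨fun v => c (v % ℓ) + k * ((v / ℓ : ℕ) : ℤ), ?_, ?_, ?_⟩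
  · intro i v q hv
    rw [hI i v q hv]
    simp [Nat.mod_eq_of_lt hv, Nat.div_eq_of_lt hv]
  · apply monotone_nat_of_le_succ
    intro v
    have hl := Nat.mod_lt v (show ℓ > 0 by omega)
    have hd := Nat.mod_add_div v ℓ
    by_cases h : v % ℓ + 1 < ℓ
    · have e : v + 1 = (v % ℓ + 1) + ℓ * (v / ℓ) := by omega
      have e1 : (v + 1) % ℓ = v % ℓ + 1 := by
        rw [e, Nat.add_mul_mod_self_left, Nat.mod_eq_of_lt h]
      have e2 : (v + 1) / ℓ = v / ℓ := by
        conv_lhs => rw [e]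
        rw [Nat.add_mul_div_left _ _ (by omega), Nat.div_eq_of_lt h]
        omega
      rw [e1, e2]
      have := hcm (show v % ℓ ≤ v % ℓ + 1 by omega)
      linarith
    · have e : v + 1 = ℓ * (v / ℓ + 1) := by rw [mul_add]; omega
      have e1 : (v + 1) % ℓ = 0 := by rw [e, Nat.mul_mod_right]
      have e2 : (v + 1) / ℓ = v / ℓ + 1 := by
        conv_lhs => rw [e]
        rw [Nat.mul_div_cancel_left _ (by omega)]
      rw [e1, e2, show v % ℓ = ℓ - 1 by omega]
      push_cast
      linarith
  · intro v
    simp only [Nat.add_mod_right, Nat.add_div_right v (show 0 < ℓ by omega)]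
    push_cast
    ring

lemma per_mul {k ℓ : ℕ} {b : ℕ → ℤ} (hper : ∀ v, b (v + ℓ) = b v + k) (v s : ℕ) :
    b (v + ℓ * s) = b v + k * s := by
  induction s with
  | zero => simp
  | succ s ih =>
    rw [mul_add, mul_one, ← add_assoc, hper, ih]
    push_cast
    ring

end Screw

open Screw in
/-- In the periodic regime, over one period `p = ℓ·n / gcd(n,k)` each
index is a bull exactly `δ = ℓ·k / gcd(n,k)` times. -/
theorem bull_count (n k ℓ : ℕ) (hk : 0 < k) (hkn : k < n) (hℓ : 1 < ℓ)
    (x : Fin n → ℤ) (hx : Monotone x) (hm : n - k ≤ mcount ℓ x)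
    (hr : rangeOf x ≤ (ℓ : ℤ)) (i : Fin n) :
    ((Finset.range (ℓ * n / Nat.gcd n k)).filter
        (fun t => i ∉ bearSet k ℓ ((gmMove k ℓ)^[t] x))).card
      = ℓ * k / Nat.gcd n k := by
  obtain ⟨b, hI, hmono, hper⟩ := exists_seq hkn hℓ x hx hm hr
  have hg : 0 < Nat.gcd n k := Nat.gcd_pos_of_pos_right _ hk
  obtain ⟨n', hn'⟩ := Nat.gcd_dvd_left n k
  obtain ⟨k', hk'⟩ := Nat.gcd_dvd_right n k
  have hp : ℓ * n / Nat.gcd n k = ℓ * n' := by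
    conv_lhs => rw [show ℓ * n = Nat.gcd n k * (ℓ * n') by
      conv_lhs => rw [hn']
      ring]
    exact Nat.mul_div_cancel_left _ hg
  have hd : ℓ * k / Nat.gcd n k = ℓ * k' := by
    conv_lhs => rw [show ℓ * k = Nat.gcd n k * (ℓ * k') by
      conv_lhs => rw [hk']
      ring]
    exact Nat.mul_div_cancel_left _ hg
  have hnk : (k : ℤ) * n' = n * k' := by
    have : k * n' = n * k' := by
      calc k * n' = (Nat.gcd n k * k') * n' := by rw [← hk']
        _ = (Nat.gcd n k * n') * k' := by ring
        _ = n * k' := by rw [← hn']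
    exact_mod_cast this
  rw [hp, hd]
  have hJ := iter_s11 hkn hℓ hI hmono hper (ℓ * n')
  have hle : ∀ z : ℤ, (gmMove k ℓ)^[ℓ * n'] x i ≤ z ↔ x i ≤ z + ℓ * k' := by
    intro z
    have h0 := Int.emod_nonneg z (b := ℓ) (by omega)
    have h1 := Int.emod_lt_of_pos z (b := ℓ) (by omega)
    have h2 := Int.emod_add_mul_ediv z ℓ
    have e1 := hJ i (z % ℓ).toNat (z / ℓ) (by omega)
    have e2 := hI i (z % ℓ).toNat (z / ℓ + k') (by omega)
    simp only [per_mul hper, hnk] at e1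
    rw [mul_add, mul_add] at e2
    rw [Int.toNat_of_nonneg h0] at e1 e2
    rw [h2] at e1
    rw [← add_assoc, h2] at e2
    rw [e1, e2]
    constructor <;> intro <;> linarith
  have hcount := count_eq k ℓ x i (ℓ * n')
  have a1 := (hle _).1 le_rfl
  have a2 := (hle (x i - ℓ * k')).2 (by linarith)
  have : ((ℓ * k' : ℕ) : ℤ) = x i - (gmMove k ℓ)^[ℓ * n'] x i := by
    push_cast
    linarith
  rw [← this] at hcount
  exact_mod_cast hcount
end

section
/- Bull runs have length divisible by ℓ: let x⁰ be a position with m(x⁰) ≥ n−k and range(x⁰) ≤ ℓ, and let x^{j+1} = G(x^j) be the GM-sequence from x⁰. Fix an index i ∈ {1,…,n} and integers j₀ ≥ 1 and t ≥ 1, and suppose that i is a bear in x^{j₀−1} and in x^{j₀+t}, while i is a bull in x^j for every j with j₀ ≤ j ≤ j₀+t−1. Then t is a multiple of ℓ; moreover, ℓ divides both x_i^{j₀} (which equals x_i^{j₀−1}) and x_i^{j₀+t}. -/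
namespace Screw

theorem bear_facts {n k ℓ : ℕ} (x : Fin n → ℤ) (h : n - k ≤ mcount ℓ x) :
    bearSet k ℓ x ⊆ mulSet ℓ x ∧ (bearSet k ℓ x).card = n - k := by
  unfold mcount at h
  have e : bearSet k ℓ x =
      (((mulSet ℓ x).toList.mergeSort (tieLE x)).take (n - k)).toFinset := by
    simp only [bearSet]
    rw [if_pos h]
  have hp := List.mergeSort_perm (mulSet ℓ x).toList (tieLE x)
  rw [e]
  constructor
  · intro a ha
    have := List.mem_of_mem_take (List.mem_toFinset.1 ha)
    exact Finset.mem_toList.1 (hp.mem_iff.1 this)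
  · rw [List.toFinset_card_of_nodup]
    · rw [List.length_take, hp.length_eq, Finset.length_toList]
      omega
    · exact (hp.nodup_iff.2 (Finset.nodup_toList _)).sublist (List.take_sublist _ _)

theorem mcount_move {n k ℓ : ℕ} (x : Fin n → ℤ) (h : n - k ≤ mcount ℓ x) :
    n - k ≤ mcount ℓ (gmMove k ℓ x) := by
  obtain ⟨h1, h2⟩ := bear_facts x h
  rw [← h2]
  apply Finset.card_le_card
  intro a ha
  have := h1 ha
  simp only [mulSet, Finset.mem_filter, Finset.mem_univ, true_and] at this ⊢
  have e : gmMove k ℓ x a = x a := if_pos ha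
  rwa [e]

theorem mcount_iter {n k ℓ : ℕ} (x : Fin n → ℤ) (h : n - k ≤ mcount ℓ x) (j : ℕ) :
    n - k ≤ mcount ℓ ((gmMove k ℓ)^[j] x) := by
  induction j with
  | zero => exact h
  | succ j ih => rw [Function.iterate_succ_apply']; exact mcount_move _ ih

end Screw

open Screw in
/-- In the periodic regime, maximal runs of bull-steps of an index have
length divisible by `ℓ`; moreover the entry is a multiple of `ℓ` at both ends of the run. -/
theorem bull_run_length (n k ℓ : ℕ) (hk : 0 < k) (hkn : k < n) (hℓ : 1 < ℓ)
    (x₀ : Fin n → ℤ) (hx : Monotone x₀) (hm : n - k ≤ mcount ℓ x₀)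
    (hr : rangeOf x₀ ≤ (ℓ : ℤ)) (i : Fin n) (j₀ t : ℕ) (hj₀ : 1 ≤ j₀) (ht : 1 ≤ t)
    (hbear₁ : i ∈ bearSet k ℓ ((gmMove k ℓ)^[j₀ - 1] x₀))
    (hbear₂ : i ∈ bearSet k ℓ ((gmMove k ℓ)^[j₀ + t] x₀))
    (hbull : ∀ j : ℕ, j₀ ≤ j → j ≤ j₀ + t - 1 → i ∉ bearSet k ℓ ((gmMove k ℓ)^[j] x₀)) :
    ℓ ∣ t ∧ (ℓ : ℤ) ∣ (gmMove k ℓ)^[j₀] x₀ i ∧ (ℓ : ℤ) ∣ (gmMove k ℓ)^[j₀ + t] x₀ i := by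
  have hd : ∀ j, i ∈ bearSet k ℓ ((gmMove k ℓ)^[j] x₀) → (ℓ : ℤ) ∣ (gmMove k ℓ)^[j] x₀ i := by
    intro j hj
    have := (bear_facts _ (mcount_iter x₀ hm j)).1 hj
    simpa [mulSet] using this
  have h1 : (ℓ : ℤ) ∣ (gmMove k ℓ)^[j₀] x₀ i := by
    have e : (gmMove k ℓ)^[j₀] x₀ i = (gmMove k ℓ)^[j₀ - 1] x₀ i := by
      obtain ⟨j, rfl⟩ : ∃ j, j₀ = j + 1 := ⟨j₀ - 1, by omega⟩
      rw [Function.iterate_succ_apply']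
      exact if_pos hbear₁
    rw [e]
    exact hd _ hbear₁
  have h2 := hd _ hbear₂
  have h3 : ∀ s : ℕ, s ≤ t → (gmMove k ℓ)^[j₀ + s] x₀ i = (gmMove k ℓ)^[j₀] x₀ i - s := by
    intro s
    induction s with
    | zero => intro _; simp
    | succ s ih =>
      intro hs
      have hb := hbull (j₀ + s) (by omega) (by omega)
      rw [← Nat.add_assoc, Function.iterate_succ_apply']
      have e : gmMove k ℓ ((gmMove k ℓ)^[j₀ + s] x₀) i = (gmMove k ℓ)^[j₀ + s] x₀ i - 1 :=
        if_neg hb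
      rw [e, ih (by omega)]
      push_cast
      ring
  refine ⟨?_, h1, h2⟩
  have h4 := h3 t le_rfl
  rw [h4] at h2
  exact Int.natCast_dvd_natCast.1 ((dvd_sub_right h1).1 h2)
end

section
/- In the game NIM(n,=k) of exact slow NIM, every position in which all pile sizes are even is a P-position (a win for the player who just moved, under normal play). -/
namespace SlowNim

/-- A legal move in NIM(n,=k): choose `k` piles, each nonempty, and remove one stone
from each of them. -/
def NimMove (n k : ℕ) (x y : Fin n → ℕ) : Prop :=
  ∃ S : Finset (Fin n), S.card = k ∧ (∀ i ∈ S, 0 < x i) ∧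
    ∀ i, y i = if i ∈ S then x i - 1 else x i

/-- P-positions of NIM(n,=k) (normal play), defined by well-founded recursion on the
total number of stones: `x` is a P-position iff every position reachable from `x` in
one move fails to be a P-position. (In particular terminal positions are P-positions.)
The hypothesis `0 < k` guarantees that every move strictly decreases the total. -/
def IsPPosition (n k : ℕ) (hk : 0 < k) (x : Fin n → ℕ) : Prop :=
  ∀ y : Fin n → ℕ, NimMove n k x y → ¬ IsPPosition n k hk y
termination_by ∑ i, x i
decreasing_by
  rename_i hmove
  obtain ⟨S, hcard, hpos, hy⟩ := hmove
  have hS : S.Nonempty := Finset.card_pos.mp (by omega)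
  obtain ⟨i₀, hi₀⟩ := hS
  refine Finset.sum_lt_sum (fun i _ => ?_) ⟨i₀, Finset.mem_univ i₀, ?_⟩
  · rw [hy i]; split <;> omega
  · rw [hy i₀]
    have := hpos i₀ hi₀
    simp [hi₀]
    omega

end SlowNim

open SlowNim in
/-- In NIM(n,=k), every position in which all pile sizes are even is a
P-position. -/
theorem all_even_isPPosition (n k : ℕ) (hk : 0 < k) (hkn : k ≤ n)
    (x : Fin n → ℕ) (heven : ∀ i, Even (x i)) :
    IsPPosition n k hk x := by
  induction hN : ∑ i, x i using Nat.strong_induction_on generalizing x with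
  | _ N ih =>
    rw [IsPPosition]
    rintro y ⟨S, hcard, hpos, hy⟩ hP
    rw [IsPPosition] at hP
    have h2 : ∀ i ∈ S, 2 ≤ x i := by
      intro i hi
      have h1 := hpos i hi
      obtain ⟨m, hm⟩ := heven i
      omega
    refine hP (fun i => if i ∈ S then x i - 2 else x i) ⟨S, hcard, ?_, ?_⟩ ?_
    · intro i hi
      have := h2 i hi
      rw [hy i, if_pos hi]
      omega
    · intro i
      by_cases hi : i ∈ S
      · simp only [hy i, if_pos hi]
        omega
      · simp only [hy i, if_neg hi]
    · refine ih _ ?_ _ ?_ rfl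
      · rw [← hN]
        obtain ⟨j, hj⟩ : S.Nonempty := Finset.card_pos.mp (by omega)
        refine Finset.sum_lt_sum (fun i _ => ?_) ⟨j, Finset.mem_univ j, ?_⟩
        · split <;> omega
        · have := h2 j hj
          rw [if_pos hj]
          omega
      · intro i
        by_cases hi : i ∈ S
        · obtain ⟨m, hm⟩ := heven i
          simp only [if_pos hi]
          exact ⟨m - 1, by omega⟩
        · simp only [if_neg hi]
          exact heven i
end
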